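/- arXiv:2101.06401 — 3 statements merged into one kernel-verified Lean document; each statement's English description precedes it below -/
import Mathlib

section
/- Let Ω ⊆ ℝ^N be a bounded connected open set and u ∈ C²(Ω) ∩ C⁰(Ω̄) be positive with 𝓜(u) = 0 on Ω. Suppose {s_t}_{t∈[0,1]} is a family of positive functions in C²(Ω) ∩ C⁰(Ω̄), depending continuously on t (in the uniform norm on Ω̄), such that 𝓜(s_t) ≤ 0 on Ω for every t ∈ [0,1], s_t > u on ∂Ω for every t ∈ (0,1], and s₁ ≥ u everywhere in Ω. Then u ≤ s₀ everywhere in Ω. -/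
open Set
noncomputable section

/-- Euclidean space `ℝ^N`. -/
abbrev Euc (N : ℕ) := EuclideanSpace ℝ (Fin N)

/-- `i`-th partial derivative `D_i u`. -/
def pd {N : ℕ} (u : Euc N → ℝ) (i : Fin N) (x : Euc N) : ℝ :=
  fderiv ℝ u x (EuclideanSpace.single i 1)

/-- Second partial derivative `D_i D_j u`. -/
def pd2 {N : ℕ} (u : Euc N → ℝ) (i j : Fin N) (x : Euc N) : ℝ :=
  fderiv ℝ (fun z => pd u j z) x (EuclideanSpace.single i 1)

/-- `|Du|²`. -/
def gradSq {N : ℕ} (u : Euc N → ℝ) (x : Euc N) : ℝ := ∑ i, (pd u i x) ^ 2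

/-- The (non-divergence form) symmetric minimal surface operator
`𝓜(u) = Δu − Σ_{i,j} (D_iu D_ju/(1+|Du|²)) D_iD_ju − (m−1)/u`. -/
def smeM (m : ℕ) {N : ℕ} (u : Euc N → ℝ) (x : Euc N) : ℝ :=
  (∑ i, pd2 u i i x)
    - (∑ i, ∑ j, (pd u i x * pd u j x / (1 + gradSq u x)) * pd2 u i j x)
    - ((m : ℝ) - 1) / u x

variable {N : ℕ}

theorem pd2_eq_fderiv_fderiv {f : Euc N → ℝ} {x : Euc N} (hf : ContDiffAt ℝ 2 f x) (i j : Fin N) :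
    pd2 f i j x = fderiv ℝ (fderiv ℝ f) x (EuclideanSpace.single i 1)
      (EuclideanSpace.single j 1) := by
  have h : DifferentiableAt ℝ (fderiv ℝ f) x :=
    (hf.fderiv_right (m := 1) (by norm_num)).differentiableAt (by norm_num)
  unfold pd2 pd
  rw [fderiv_clm_apply h (differentiableAt_const _)]
  simp

theorem pd_sub {f g : Euc N → ℝ} {x : Euc N} (hf : DifferentiableAt ℝ f x)
    (hg : DifferentiableAt ℝ g x) (i : Fin N) :
    pd (fun z => f z - g z) i x = pd f i x - pd g i x := by
  simp [pd, fderiv_fun_sub hf hg]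

theorem pd2_sub {f g : Euc N → ℝ} {x : Euc N} (hf : ContDiffAt ℝ 2 f x)
    (hg : ContDiffAt ℝ 2 g x) (i j : Fin N) :
    pd2 (fun z => f z - g z) i j x = pd2 f i j x - pd2 g i j x := by
  have hd {h : Euc N → ℝ} (hh : ContDiffAt ℝ 2 h x) :
      DifferentiableAt ℝ (fun z => pd h j z) x :=
    ((hh.fderiv_right (m := 1) (by norm_num)).differentiableAt (by norm_num)).clm_apply
      (differentiableAt_const _)
  have h : (fun z => pd (fun z => f z - g z) j z) =ᶠ[nhds x] fun z => pd f j z - pd g j z := by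
    filter_upwards [hf.eventually (by simp), hg.eventually (by simp)] with z hz hz'
    exact pd_sub (hz.differentiableAt (by norm_num)) (hz'.differentiableAt (by norm_num)) j
  unfold pd2
  rw [h.fderiv_eq, fderiv_fun_sub (hd hf) (hd hg)]
  rfl

theorem ContDiffOn.continuousOn_pd {Ω : Set (Euc N)} (hΩ : IsOpen Ω) {f : Euc N → ℝ}
    (hf : ContDiffOn ℝ 2 f Ω) (i : Fin N) : ContinuousOn (fun x => pd f i x) Ω :=
  (hf.continuousOn_fderiv_of_isOpen hΩ (by norm_num)).clm_apply continuousOn_const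

theorem ContDiffOn.continuousOn_pd2 {Ω : Set (Euc N)} (hΩ : IsOpen Ω) {f : Euc N → ℝ}
    (hf : ContDiffOn ℝ 2 f Ω) (i j : Fin N) : ContinuousOn (fun x => pd2 f i j x) Ω := by
  have h : ContDiffOn ℝ 1 (fun z => pd f j z) Ω :=
    (hf.fderiv_of_isOpen (m := 1) hΩ (by norm_num)).clm_apply contDiffOn_const
  exact (h.continuousOn_fderiv_of_isOpen hΩ (by norm_num)).clm_apply continuousOn_const

theorem IsLocalMin.deriv_deriv_nonneg {g : ℝ → ℝ} {a : ℝ} (h : IsLocalMin g a)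
    (hc : ContinuousAt g a) : 0 ≤ deriv (deriv g) a := by
  by_contra! hneg
  have hmax := isLocalMax_of_deriv_deriv_neg hneg h.deriv_eq_zero hc
  have hconst : g =ᶠ[nhds a] fun _ => g a := by
    filter_upwards [h, hmax] with t h₁ h₂ using le_antisymm h₂ h₁
  have : deriv (deriv g) a = 0 := by
    rw [hconst.deriv.deriv_eq]
    simp
  linarith

theorem IsLocalMin.fderiv_fderiv_nonneg {E : Type*} [NormedAddCommGroup E] [NormedSpace ℝ E]
    {f : E → ℝ} {x : E} (h : IsLocalMin f x) (hf : ContDiffAt ℝ 2 f x) (ξ : E) :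
    0 ≤ fderiv ℝ (fderiv ℝ f) x ξ ξ := by
  have hl (t : ℝ) : HasDerivAt (fun t : ℝ => x + t • ξ) ξ t := by
    simpa using ((hasDerivAt_id t).smul_const ξ).const_add x
  have hx : x + (0 : ℝ) • ξ = x := by simp
  have htend : Filter.Tendsto (fun t : ℝ => x + t • ξ) (nhds 0) (nhds x) := by
    simpa using (hl 0).continuousAt.tendsto
  have hmin : IsLocalMin (fun t : ℝ => f (x + t • ξ)) 0 := by
    filter_upwards [htend.eventually h] with t ht
    simpa using ht
  have hd : deriv (fun t : ℝ => f (x + t • ξ)) =ᶠ[nhds 0] fun t => fderiv ℝ f (x + t • ξ) ξ := by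
    filter_upwards [htend.eventually (hf.eventually (by simp))] with t ht
    exact ((ht.differentiableAt (by norm_num)).hasFDerivAt.comp_hasDerivAt t (hl t)).deriv
  have hF : HasFDerivAt (fun z => fderiv ℝ f z ξ) ((fderiv ℝ (fderiv ℝ f) x).flip ξ)
      (x + (0 : ℝ) • ξ) := by
    have h₁ := ((hf.fderiv_right (m := 1) (by norm_num)).differentiableAt
      (by norm_num)).hasFDerivAt.clm_apply (hasFDerivAt_const ξ x)
    rw [hx]
    simpa using h₁
  have hdd : deriv (fun t : ℝ => fderiv ℝ f (x + t • ξ) ξ) 0 = fderiv ℝ (fderiv ℝ f) x ξ ξ :=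
    (hF.comp_hasDerivAt (f := fun t : ℝ => x + t • ξ) 0 (hl 0)).deriv
  have hc : ContinuousAt (fun t : ℝ => f (x + t • ξ)) 0 :=
    ContinuousAt.comp (f := fun t : ℝ => x + t • ξ) (hx.symm ▸ hf.continuousAt)
      (hl 0).continuousAt
  rw [← hdd, ← hd.deriv_eq]
  exact hmin.deriv_deriv_nonneg hc

theorem pd_exp_neg_sq (α b c : ℝ) (y x : Euc N) (i : Fin N) :
    pd (fun z => c * (Real.exp (-α * ‖z - y‖ ^ 2) - b)) i x
      = c * (-2 * α * (x i - y i) * Real.exp (-α * ‖x - y‖ ^ 2)) := by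
  have h : HasFDerivAt (fun z : Euc N => ‖z - y‖ ^ 2) (2 • innerSL ℝ (x - y)) x := by
    simpa using ((hasFDerivAt_id x).sub_const y).norm_sq
  have := (((h.const_mul (-α)).exp).sub_const b).const_mul c
  unfold pd
  rw [this.fderiv]
  simp [EuclideanSpace.inner_single_right, -mul_eq_mul_left_iff]
  ring

theorem pd2_exp_neg_sq (α b c : ℝ) (y x : Euc N) (i j : Fin N) :
    pd2 (fun z => c * (Real.exp (-α * ‖z - y‖ ^ 2) - b)) i j x
      = c * ((4 * α ^ 2 * (x i - y i) * (x j - y j) - if i = j then 2 * α else 0)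
        * Real.exp (-α * ‖x - y‖ ^ 2)) := by
  have h : HasFDerivAt (fun z : Euc N => ‖z - y‖ ^ 2) (2 • innerSL ℝ (x - y)) x := by
    simpa using ((hasFDerivAt_id x).sub_const y).norm_sq
  have hj : HasFDerivAt (fun z : Euc N => z j - y j) (EuclideanSpace.proj j : Euc N →L[ℝ] ℝ) x :=
    (EuclideanSpace.proj j : Euc N →L[ℝ] ℝ).hasFDerivAt.sub_const _
  have := ((hj.const_mul (-2 * α)).fun_mul ((h.const_mul (-α)).exp)).const_mul c
  unfold pd2
  simp only [pd_exp_neg_sq]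
  rw [this.fderiv]
  simp [EuclideanSpace.inner_single_right]
  split_ifs with h₁ h₂ h₂
  · ring
  · exact absurd h₁.symm h₂
  · exact absurd h₂.symm h₁
  · ring

/-- The linear operator `(1 + |p|²) Δw - ∑ p_i p_j D_iD_j w + ∑ β_i D_i w`. -/
def smeLin {N : ℕ} (p β : Fin N → ℝ) (w : Euc N → ℝ) (x : Euc N) : ℝ :=
  (1 + ∑ k, p k ^ 2) * ∑ i, pd2 w i i x - (∑ i, ∑ j, p i * p j * pd2 w i j x)
    + ∑ i, β i * pd w i x

theorem smeLin_sub (p β : Fin N → ℝ) {f g : Euc N → ℝ} {x : Euc N} (hf : ContDiffAt ℝ 2 f x)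
    (hg : ContDiffAt ℝ 2 g x) :
    smeLin p β (fun z => f z - g z) x = smeLin p β f x - smeLin p β g x := by
  simp only [smeLin, pd2_sub hf hg,
    pd_sub (hf.differentiableAt (by norm_num)) (hg.differentiableAt (by norm_num)), mul_sub,
    Finset.sum_sub_distrib]
  ring

theorem smeLin_nonneg_of_isLocalMin (p β : Fin N → ℝ) {f : Euc N → ℝ} {x : Euc N}
    (h : IsLocalMin f x) (hf : ContDiffAt ℝ 2 f x) : 0 ≤ smeLin p β f x := by
  have hpd (i : Fin N) : pd f i x = 0 := by simp [pd, h.fderiv_eq_zero]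
  have hdiag (i : Fin N) : 0 ≤ pd2 f i i x := by
    rw [pd2_eq_fderiv_fderiv hf]
    exact h.fderiv_fderiv_nonneg hf _
  have hij (i j : Fin N) : 0 ≤ p i ^ 2 * pd2 f j j x + p j ^ 2 * pd2 f i i x
      - p i * p j * pd2 f i j x - p j * p i * pd2 f j i x := by
    have := h.fderiv_fderiv_nonneg hf
      (p i • EuclideanSpace.single j 1 - p j • EuclideanSpace.single i 1)
    simp only [map_sub, map_smul, sub_apply, smul_apply, smul_eq_mul,
      ← pd2_eq_fderiv_fderiv hf] at this
    linarith
  have hsum := Finset.sum_nonneg fun i (_ : i ∈ Finset.univ) =>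
    Finset.sum_nonneg fun j (_ : j ∈ Finset.univ) => hij i j
  simp only [Finset.sum_sub_distrib, Finset.sum_add_distrib] at hsum
  rw [← Finset.sum_mul_sum, Finset.sum_comm (f := fun i j => p j ^ 2 * pd2 f i i x),
    ← Finset.sum_mul_sum, Finset.sum_comm (f := fun i j => p j * p i * pd2 f j i x)] at hsum
  have htr : 0 ≤ ∑ i, pd2 f i i x := Finset.sum_nonneg fun i _ => hdiag i
  simp only [smeLin, hpd, mul_zero, Finset.sum_const_zero, add_zero]
  linarith

theorem smeLin_exp_neg_sq_pos (p β : Fin N → ℝ) {α b c : ℝ} (hα : 0 < α) (hc : 0 < c)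
    (y x : Euc N)
    (h : 2 * N * (1 + ∑ k, p k ^ 2) + 2 * (∑ i, β i * (x i - y i)) - 2 * ∑ k, p k ^ 2
      < 4 * α * ‖x - y‖ ^ 2) :
    0 < smeLin p β (fun z => c * (Real.exp (-α * ‖z - y‖ ^ 2) - b)) x := by
  have hE := Real.exp_pos (-α * ‖x - y‖ ^ 2)
  set E := Real.exp (-α * ‖x - y‖ ^ 2) with hEdef
  have hnorm : ‖x - y‖ ^ 2 = ∑ i, (x i - y i) ^ 2 := by
    simp [EuclideanSpace.real_norm_sq_eq]
  have hcs := Finset.sum_mul_sq_le_sq_mul_sq Finset.univ p (fun i => x i - y i)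
  have h₁ : ∑ i, pd2 (fun z => c * (Real.exp (-α * ‖z - y‖ ^ 2) - b)) i i x
      = c * E * (4 * α ^ 2 * (∑ i, (x i - y i) ^ 2) - 2 * α * N) := by
    have : (2 * α * N : ℝ) = ∑ _i : Fin N, 2 * α := by simp; ring
    rw [this, Finset.mul_sum, ← Finset.sum_sub_distrib, Finset.mul_sum]
    refine Finset.sum_congr rfl fun i _ => ?_
    rw [pd2_exp_neg_sq, if_pos rfl]
    ring
  have h₂ : ∑ i, ∑ j, p i * p j * pd2 (fun z => c * (Real.exp (-α * ‖z - y‖ ^ 2) - b)) i j x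
      = c * E * (4 * α ^ 2 * (∑ i, p i * (x i - y i)) ^ 2 - 2 * α * ∑ k, p k ^ 2) := by
    have hd : ∑ k, p k ^ 2 = ∑ i, ∑ j, p i * p j * if i = j then 1 else 0 := by
      simp [sq]
    rw [hd, sq (∑ i, p i * (x i - y i)), Finset.sum_mul_sum]
    simp only [Finset.mul_sum, ← Finset.sum_sub_distrib]
    refine Finset.sum_congr rfl fun i _ => Finset.sum_congr rfl fun j _ => ?_
    rw [pd2_exp_neg_sq]
    split_ifs <;> ring
  have h₃ : ∑ i, β i * pd (fun z => c * (Real.exp (-α * ‖z - y‖ ^ 2) - b)) i x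
      = c * E * (-2 * α * ∑ i, β i * (x i - y i)) := by
    simp only [Finset.mul_sum]
    refine Finset.sum_congr rfl fun i _ => ?_
    rw [pd_exp_neg_sq]
    ring
  rw [smeLin, h₁, h₂, h₃]
  rw [hnorm] at h
  have hk := mul_le_mul_of_nonneg_left hcs (by positivity : 0 ≤ 4 * α ^ 2)
  have hk' := mul_lt_mul_of_pos_left h hα
  have : 0 < c * E * ((1 + ∑ k, p k ^ 2) * (4 * α ^ 2 * (∑ i, (x i - y i) ^ 2) - 2 * α * N)
      - (4 * α ^ 2 * (∑ i, p i * (x i - y i)) ^ 2 - 2 * α * ∑ k, p k ^ 2)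
      + -2 * α * ∑ i, β i * (x i - y i)) := by
    refine mul_pos (mul_pos hc hE) ?_
    linarith
  linarith

/-- Hopf's argument: a nonnegative supersolution cannot have a zero on the boundary of a ball
inside the domain on which it is otherwise positive. -/
theorem false_of_touching_ball {Ω : Set (Euc N)} (hΩ : IsOpen Ω) {w : Euc N → ℝ}
    (hw : ContDiffOn ℝ 2 w Ω) (hw0 : ∀ x ∈ Ω, 0 ≤ w x) {p β : Euc N → Fin N → ℝ}
    (hp : ContinuousOn p Ω) (hβ : ContinuousOn β Ω) (hL : ∀ x ∈ Ω, smeLin (p x) (β x) w x ≤ 0)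
    {y z : Euc N} (hz : z ∈ Ω) (hyz : z ≠ y) (hwz : w z = 0)
    (hball : ∀ x ∈ Ω, ‖x - y‖ ≤ ‖z - y‖ → x ≠ z → 0 < w x) : False := by
  have hρ : 0 < ‖z - y‖ := norm_pos_iff.2 (sub_ne_zero.2 hyz)
  set ρ := ‖z - y‖ with hρdef
  obtain ⟨r₀, hr₀, hr₀Ω⟩ := Metric.isOpen_iff.1 hΩ z hz
  obtain ⟨r, hr, hrρ, hrr₀⟩ : ∃ r > 0, r ≤ ρ / 2 ∧ r < r₀ :=
    ⟨min (ρ / 2) (r₀ / 2), by positivity, min_le_left _ _,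
      (min_le_right _ _).trans_lt (by linarith)⟩
  have hKΩ : Metric.closedBall z r ⊆ Ω := (Metric.closedBall_subset_ball hrr₀).trans hr₀Ω
  have hK : IsCompact (Metric.closedBall z r) := isCompact_closedBall z r
  have hfar : ∀ x ∈ Metric.closedBall z r, ρ / 2 ≤ ‖x - y‖ := by
    intro x hx
    rw [mem_closedBall_iff_norm'] at hx
    have := norm_sub_le_norm_sub_add_norm_sub z x y
    linarith
  obtain ⟨C, hC⟩ := (hK.image_of_continuousOn (f := fun x : Euc N =>
      2 * N * (1 + ∑ k, p x k ^ 2) + 2 * (∑ i, β x i * (x i - y i)) - 2 * ∑ k, p x k ^ 2) (by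
    have hp' (k : Fin N) : ContinuousOn (fun x => p x k) (Metric.closedBall z r) :=
      (continuousOn_pi.1 hp k).mono hKΩ
    have hβ' (k : Fin N) : ContinuousOn (fun x => β x k) (Metric.closedBall z r) :=
      (continuousOn_pi.1 hβ k).mono hKΩ
    fun_prop)).bddAbove
  obtain ⟨α, hα, hαC⟩ : ∃ α > 0, C < α * ρ ^ 2 := by
    refine ⟨(|C| + 1) / ρ ^ 2, by positivity, ?_⟩
    rw [div_mul_cancel₀ _ (by positivity)]
    linarith [le_abs_self C]
  obtain ⟨c, hc, hcw⟩ : ∃ c > 0, ∀ x ∈ Metric.sphere z r, ‖x - y‖ ≤ ρ → c ≤ w x := by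
    have hK₁ : IsCompact (Metric.sphere z r ∩ Metric.closedBall y ρ) :=
      (isCompact_sphere z r).inter_right Metric.isClosed_closedBall
    have hsub : Metric.sphere z r ∩ Metric.closedBall y ρ ⊆ Ω :=
      inter_subset_left.trans (Metric.sphere_subset_closedBall.trans hKΩ)
    rcases (Metric.sphere z r ∩ Metric.closedBall y ρ).eq_empty_or_nonempty with he | hne
    · refine ⟨1, one_pos, fun x hx hxy => ?_⟩
      have : x ∈ Metric.sphere z r ∩ Metric.closedBall y ρ :=
        ⟨hx, mem_closedBall_iff_norm.2 hxy⟩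
      simp [he] at this
    · obtain ⟨x₁, hx₁, hmin⟩ := hK₁.exists_isMinOn hne (hw.continuousOn.mono hsub)
      refine ⟨w x₁, hball x₁ (hsub hx₁) (mem_closedBall_iff_norm.1 hx₁.2) ?_,
        fun x hx hxy => hmin ⟨hx, mem_closedBall_iff_norm.2 hxy⟩⟩
      rintro rfl
      simpa [hr.ne] using hx₁.1
  let v : Euc N → ℝ := fun x => c * (Real.exp (-α * ‖x - y‖ ^ 2) - Real.exp (-α * ρ ^ 2))
  have hv : ContDiff ℝ 2 v := by
    have : ContDiff ℝ 2 fun x : Euc N => ‖x - y‖ ^ 2 := (contDiff_id.sub contDiff_const).norm_sq ℝ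
    exact contDiff_const.mul ((contDiff_const.mul this).exp.sub contDiff_const)
  have hfz : w z - v z = 0 := by simp [v, hwz, ← hρdef]
  have hsphere : ∀ x ∈ Metric.sphere z r, 0 ≤ w x - v x := by
    intro x hx
    have hxΩ := hKΩ (Metric.sphere_subset_closedBall hx)
    by_cases hxy : ‖x - y‖ ≤ ρ
    · have h₁ : Real.exp (-α * ‖x - y‖ ^ 2) ≤ 1 := by
        rw [Real.exp_le_one_iff]
        have : 0 ≤ α * ‖x - y‖ ^ 2 := by positivity
        linarith
      have h₂ := Real.exp_pos (-α * ρ ^ 2)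
      have h₃ : v x ≤ c * 1 := mul_le_mul_of_nonneg_left (by linarith) hc.le
      linarith [hcw x hx hxy]
    · have h₁ : ρ ^ 2 ≤ ‖x - y‖ ^ 2 := by
        gcongr
        exact (not_le.1 hxy).le
      have h₂ : Real.exp (-α * ‖x - y‖ ^ 2) ≤ Real.exp (-α * ρ ^ 2) := by
        rw [Real.exp_le_exp]
        nlinarith
      have h₃ : v x ≤ 0 := mul_nonpos_of_nonneg_of_nonpos hc.le (by linarith)
      linarith [hw0 x hxΩ]
  obtain ⟨x₁, hx₁, hmin⟩ : ∃ x₁ ∈ Metric.ball z r,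
      IsMinOn (fun x => w x - v x) (Metric.closedBall z r) x₁ := by
    obtain ⟨x₁, hx₁, hmin⟩ := hK.exists_isMinOn ⟨z, Metric.mem_closedBall_self hr.le⟩
      ((hw.continuousOn.mono hKΩ).sub hv.continuous.continuousOn)
    by_cases hxb : x₁ ∈ Metric.ball z r
    · exact ⟨x₁, hxb, hmin⟩
    · refine ⟨z, Metric.mem_ball_self hr, fun x hx => ?_⟩
      have hxs : x₁ ∈ Metric.sphere z r := le_antisymm hx₁ (not_lt.1 hxb)
      have h₁ : w x₁ - v x₁ ≤ w x - v x := hmin hx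
      have h₂ := hsphere x₁ hxs
      change w z - v z ≤ w x - v x
      linarith
  have hx₁K := Metric.ball_subset_closedBall hx₁
  have hloc : IsLocalMin (fun x => w x - v x) x₁ :=
    hmin.isLocalMin (Filter.mem_of_superset (Metric.isOpen_ball.mem_nhds hx₁)
      Metric.ball_subset_closedBall)
  have hwx : ContDiffAt ℝ 2 w x₁ := hw.contDiffAt (hΩ.mem_nhds (hKΩ hx₁K))
  have h₁ := smeLin_nonneg_of_isLocalMin (p x₁) (β x₁) hloc (hwx.sub hv.contDiffAt)
  rw [smeLin_sub _ _ hwx hv.contDiffAt] at h₁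
  have h₂ : 0 < smeLin (p x₁) (β x₁) v x₁ := by
    refine smeLin_exp_neg_sq_pos _ _ hα hc y x₁ ?_
    have h₃ := hC (mem_image_of_mem _ hx₁K)
    have h₄ : (ρ / 2) ^ 2 ≤ ‖x₁ - y‖ ^ 2 := by
      gcongr
      exact hfar x₁ hx₁K
    have h₅ := mul_le_mul_of_nonneg_left h₄ hα.le
    simp only at h₃
    linarith
  linarith [hL x₁ (hKΩ hx₁K)]

theorem eq_of_norm_sub_le_of_norm_add_ge {E : Type*} [NormedAddCommGroup E]
    [InnerProductSpace ℝ E] {a b : E} (h : ‖a‖ ≤ ‖b‖) (h' : 2 * ‖b‖ ≤ ‖a + b‖) : a = b := by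
  have hp := parallelogram_law_with_norm ℝ a b
  have : ‖a - b‖ * ‖a - b‖ ≤ 0 := by nlinarith [norm_nonneg a, norm_nonneg b]
  have h0 : ‖a - b‖ = 0 := by nlinarith [norm_nonneg (a - b)]
  exact sub_eq_zero.1 (norm_eq_zero.1 h0)

/-- Strong maximum principle for nonnegative supersolutions of `smeLin`. -/
theorem eq_zero_of_smeLin_nonpos {Ω : Set (Euc N)} (hΩ : IsOpen Ω) (hconn : IsPreconnected Ω)
    {w : Euc N → ℝ}
    (hw : ContDiffOn ℝ 2 w Ω) (hw0 : ∀ x ∈ Ω, 0 ≤ w x) {p β : Euc N → Fin N → ℝ}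
    (hp : ContinuousOn p Ω) (hβ : ContinuousOn β Ω) (hL : ∀ x ∈ Ω, smeLin (p x) (β x) w x ≤ 0)
    {x₀ : Euc N} (hx₀ : x₀ ∈ Ω) (hwx₀ : w x₀ = 0) : ∀ x ∈ Ω, w x = 0 := by
  have hpos_open : IsOpen {x ∈ Ω | w x ≠ 0} :=
    hw.continuousOn.isOpen_inter_preimage hΩ isOpen_ne
  have hzero_open : IsOpen {x ∈ Ω | w x = 0} := by
    rw [Metric.isOpen_iff]
    rintro x ⟨hx, hwx⟩
    obtain ⟨r, hr, hrΩ⟩ := Metric.isOpen_iff.1 hΩ x hx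
    refine ⟨r / 4, by positivity, fun y hy => ?_⟩
    rw [Metric.mem_ball] at hy
    have hyΩ : y ∈ Ω := hrΩ (Metric.mem_ball.2 (by linarith))
    refine ⟨hyΩ, ?_⟩
    by_contra hwy
    have hsub : Metric.closedBall x (r / 2) ⊆ Ω :=
      (Metric.closedBall_subset_ball (by linarith)).trans hrΩ
    have hZ : IsCompact (Metric.closedBall x (r / 2) ∩ w ⁻¹' {0}) :=
      (isCompact_closedBall x (r / 2)).of_isClosed_subset
        ((hw.continuousOn.mono hsub).preimage_isClosed_of_isClosed Metric.isClosed_closedBall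
          isClosed_singleton) inter_subset_left
    obtain ⟨z, ⟨hzK, hwz⟩, hzmin⟩ := hZ.exists_isMinOn
      ⟨x, Metric.mem_closedBall_self (by positivity), hwx⟩
      (f := fun z => ‖z - y‖) (by fun_prop)
    have hwz : w z = 0 := hwz
    have hzy : z ≠ y := by rintro rfl; exact hwy hwz
    have hzx : ‖z - y‖ < r / 4 := by
      have h₁ : ‖z - y‖ ≤ ‖x - y‖ := hzmin ⟨Metric.mem_closedBall_self (by positivity), hwx⟩
      rw [dist_comm, dist_eq_norm] at hy
      linarith
    set b : Euc N := (2⁻¹ : ℝ) • (z - y) with hb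
    have hzb : z - (y + b) = b := by
      rw [hb]
      module
    have hb2 : 2 * ‖b‖ = ‖z - y‖ := by
      rw [hb, norm_smul]
      norm_num
      ring
    have hb0 : b ≠ 0 := by
      rw [hb]
      simpa [sub_eq_zero] using hzy
    refine false_of_touching_ball hΩ hw hw0 hp hβ hL (y := y + b) (hsub hzK) ?_ hwz ?_
    · rw [← sub_ne_zero, hzb]
      exact hb0
    · intro q hq hqy hqz
      rw [hzb] at hqy
      refine (hw0 q hq).lt_of_ne' fun hwq => hqz ?_
      have hqy' : q - (y + b) + b = q - y := by abel
      have htri : ‖q - y‖ ≤ ‖z - y‖ := by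
        rw [← hqy', ← hb2]
        linarith [norm_add_le (q - (y + b)) b]
      have hqK : q ∈ Metric.closedBall x (r / 2) := by
        rw [Metric.mem_closedBall]
        have := dist_triangle q y x
        rw [dist_eq_norm q y] at this
        linarith
      have hge : ‖z - y‖ ≤ ‖q - y‖ := hzmin ⟨hqK, hwq⟩
      have := eq_of_norm_sub_le_of_norm_add_ge hqy (by rw [hqy', hb2]; exact hge)
      exact sub_left_injective (this.trans hzb.symm)
  intro x hx
  have hsub := hconn.subset_left_of_subset_union hzero_open hpos_open
    (by rw [Set.disjoint_left]; exact fun a ha hb => hb.2 ha.2)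
    (fun a ha => by by_cases h : w a = 0 <;> simp [ha, h]) ⟨x₀, hx₀, hx₀, hwx₀⟩
  exact (hsub hx).2

theorem one_add_gradSq_mul_smeM (m : ℕ) (u : Euc N → ℝ) (x : Euc N) :
    (1 + gradSq u x) * smeM m u x
      = (1 + gradSq u x) * (∑ i, pd2 u i i x) - (∑ i, ∑ j, pd u i x * pd u j x * pd2 u i j x)
        - (1 + gradSq u x) * (((m : ℝ) - 1) / u x) := by
  have hg : 1 + gradSq u x ≠ 0 := by
    have : 0 ≤ gradSq u x := Finset.sum_nonneg fun i _ => sq_nonneg _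
    positivity
  have h : (1 + gradSq u x) * (∑ i, ∑ j, pd u i x * pd u j x / (1 + gradSq u x) * pd2 u i j x)
      = ∑ i, ∑ j, pd u i x * pd u j x * pd2 u i j x := by
    simp only [Finset.mul_sum]
    refine Finset.sum_congr rfl fun i _ => Finset.sum_congr rfl fun j _ => ?_
    field_simp
  rw [smeM, mul_sub, mul_sub, h]

/-- First order coefficients of the linear inequality satisfied by the difference `s - u` of a
supersolution and a solution. -/
def smeDrift (m : ℕ) {N : ℕ} (s u : Euc N → ℝ) (x : Euc N) (i : Fin N) : ℝ :=
  (pd s i x + pd u i x) * ((∑ k, pd2 u k k x) - ((m : ℝ) - 1) / u x)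
    - (∑ j, pd2 u i j x * pd s j x) - ∑ j, pd2 u j i x * pd u j x

theorem sum_smeDrift_mul (m : ℕ) (s u : Euc N → ℝ) (x : Euc N) :
    ∑ i, smeDrift m s u x i * (pd s i x - pd u i x)
      = (gradSq s x - gradSq u x) * ((∑ k, pd2 u k k x) - ((m : ℝ) - 1) / u x)
        - (∑ i, ∑ j, pd s i x * pd s j x * pd2 u i j x)
        + ∑ i, ∑ j, pd u i x * pd u j x * pd2 u i j x := by
  have h₁ : ∑ i, (∑ j, pd2 u i j x * pd s j x) * (pd s i x - pd u i x)
      = (∑ i, ∑ j, pd s i x * pd s j x * pd2 u i j x)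
        - ∑ i, ∑ j, pd u i x * pd s j x * pd2 u i j x := by
    simp only [Finset.sum_mul, ← Finset.sum_sub_distrib]
    exact Finset.sum_congr rfl fun i _ => Finset.sum_congr rfl fun j _ => by ring
  have h₂ : ∑ i, (∑ j, pd2 u j i x * pd u j x) * (pd s i x - pd u i x)
      = (∑ i, ∑ j, pd u i x * pd s j x * pd2 u i j x)
        - ∑ i, ∑ j, pd u i x * pd u j x * pd2 u i j x := by
    simp only [Finset.sum_mul, ← Finset.sum_sub_distrib]
    rw [Finset.sum_comm]
    exact Finset.sum_congr rfl fun i _ => Finset.sum_congr rfl fun j _ => by ring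
  have h₃ : ∑ i, (pd s i x + pd u i x) * ((∑ k, pd2 u k k x) - ((m : ℝ) - 1) / u x)
        * (pd s i x - pd u i x)
      = (gradSq s x - gradSq u x) * ((∑ k, pd2 u k k x) - ((m : ℝ) - 1) / u x) := by
    simp only [gradSq, Finset.sum_mul, ← Finset.sum_sub_distrib]
    exact Finset.sum_congr rfl fun i _ => by ring
  simp only [smeDrift, sub_mul, Finset.sum_sub_distrib] at *
  linarith

theorem smeLin_sub_nonpos {m : ℕ} (hm : 1 ≤ m) {s u : Euc N → ℝ} {x : Euc N}
    (hs : ContDiffAt ℝ 2 s x) (hu : ContDiffAt ℝ 2 u x) (hupos : 0 < u x) (hsu : u x ≤ s x)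
    (husol : smeM m u x = 0) (hsup : smeM m s x ≤ 0) :
    smeLin (fun i => pd s i x) (smeDrift m s u x) (fun z => s z - u z) x ≤ 0 := by
  have h₁ := one_add_gradSq_mul_smeM m u x
  have h₂ := one_add_gradSq_mul_smeM m s x
  have h₃ := sum_smeDrift_mul m s u x
  have hg : 0 ≤ gradSq s x := Finset.sum_nonneg fun i _ => sq_nonneg _
  have h₄ : (1 + gradSq s x) * smeM m s x ≤ 0 :=
    mul_nonpos_of_nonneg_of_nonpos (by positivity) hsup
  rw [husol, mul_zero] at h₁
  have hm' : (0 : ℝ) ≤ (m : ℝ) - 1 := sub_nonneg.2 (by exact_mod_cast hm)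
  have h₅ : ((m : ℝ) - 1) / s x ≤ ((m : ℝ) - 1) / u x := by gcongr
  have h₆ := mul_le_mul_of_nonneg_left h₅ (by positivity : 0 ≤ 1 + gradSq s x)
  rw [smeLin_sub _ _ hs hu]
  have h₇ : ∑ i, smeDrift m s u x i * (pd s i x - pd u i x)
      = (∑ i, smeDrift m s u x i * pd s i x) - ∑ i, smeDrift m s u x i * pd u i x := by
    simp only [mul_sub, Finset.sum_sub_distrib]
  have hgs : ∑ k, pd s k x ^ 2 = gradSq s x := rfl
  simp only [smeLin, hgs]
  linarith

theorem ContDiffOn.continuousOn_smeDrift (m : ℕ) {Ω : Set (Euc N)} (hΩ : IsOpen Ω)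
    {s u : Euc N → ℝ} (hs : ContDiffOn ℝ 2 s Ω) (hu : ContDiffOn ℝ 2 u Ω)
    (hu0 : ∀ x ∈ Ω, u x ≠ 0) : ContinuousOn (smeDrift m s u) Ω := by
  have h₁ := hs.continuousOn_pd hΩ
  have h₂ := hu.continuousOn_pd hΩ
  have h₃ := hu.continuousOn_pd2 hΩ
  have h₄ : ContinuousOn (fun x => ((m : ℝ) - 1) / u x) Ω :=
    continuousOn_const.div hu.continuousOn hu0
  refine continuousOn_pi.2 fun i => ?_
  unfold smeDrift
  fun_prop

/-- A supersolution lying above a solution and strictly above it somewhere on the boundary lies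
strictly above it. -/
theorem lt_of_smeM_nonpos {m : ℕ} (hm : 1 ≤ m) {Ω : Set (Euc N)} (hΩ : IsOpen Ω)
    (hconn : IsPreconnected Ω) {s u : Euc N → ℝ} (hs : ContDiffOn ℝ 2 s Ω)
    (hu : ContDiffOn ℝ 2 u Ω) (hs0 : ContinuousOn s (closure Ω))
    (hu0 : ContinuousOn u (closure Ω)) (hupos : ∀ x ∈ Ω, 0 < u x)
    (husol : ∀ x ∈ Ω, smeM m u x = 0) (hsup : ∀ x ∈ Ω, smeM m s x ≤ 0)
    (hle : ∀ x ∈ Ω, u x ≤ s x) (hbdry : ∃ x ∈ frontier Ω, u x < s x) :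
    ∀ x ∈ Ω, u x < s x := by
  intro x hx
  refine (hle x hx).lt_of_ne fun hxe => ?_
  have hzero := eq_zero_of_smeLin_nonpos hΩ hconn (w := fun z => s z - u z) (hs.sub hu)
    (fun x hx => sub_nonneg.2 (hle x hx)) (p := fun x i => pd s i x)
    (continuousOn_pi.2 fun i => hs.continuousOn_pd hΩ i)
    (hs.continuousOn_smeDrift m hΩ hu fun x hx => (hupos x hx).ne')
    (fun x hx => smeLin_sub_nonpos hm (hs.contDiffAt (hΩ.mem_nhds hx))
      (hu.contDiffAt (hΩ.mem_nhds hx)) (hupos x hx) (hle x hx) (husol x hx) (hsup x hx))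
    hx (by simp [hxe])
  obtain ⟨y, hy, hlt⟩ := hbdry
  have heq : EqOn s u (closure Ω) :=
    EqOn.of_subset_closure (fun x hx => sub_eq_zero.1 (hzero x hx)) hs0 hu0 subset_closure
      subset_rfl
  exact hlt.ne' (heq (frontier_subset_closure hy))

/-- Sliding family of supersolutions (Lemma (i) of the paper):
if `u` is a positive solution of the SME on a bounded connected open set `Ω`,
continuous on `Ω̄`, and `{s_t}_{t ∈ [0,1]}` is a family of positive supersolutions,
continuous in `t` in the uniform norm on `Ω̄`, with `s_t > u` on `∂Ω` for `t ∈ (0,1]`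
and `s₁ ≥ u` on `Ω`, then `u ≤ s₀` on `Ω`. -/
theorem sme_supersolution_sliding
    (m N : ℕ) (hm : 2 ≤ m) (hN : 2 ≤ N)
    (Ω : Set (Euc N)) (hΩ : IsOpen Ω) (hbdd : Bornology.IsBounded Ω) (hconn : IsConnected Ω)
    (u : Euc N → ℝ)
    (hu2 : ContDiffOn ℝ 2 u Ω) (hu0 : ContinuousOn u (closure Ω))
    (hupos : ∀ x ∈ closure Ω, 0 < u x)
    (husol : ∀ x ∈ Ω, smeM m u x = 0)
    (s : ℝ → Euc N → ℝ)
    (hs2 : ∀ t ∈ Icc (0:ℝ) 1, ContDiffOn ℝ 2 (s t) Ω)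
    (hs0 : ∀ t ∈ Icc (0:ℝ) 1, ContinuousOn (s t) (closure Ω))
    (hspos : ∀ t ∈ Icc (0:ℝ) 1, ∀ x ∈ closure Ω, 0 < s t x)
    (hscont : ∀ t₀ ∈ Icc (0:ℝ) 1, ∀ ε > (0:ℝ), ∃ δ > (0:ℝ), ∀ t ∈ Icc (0:ℝ) 1,
        |t - t₀| < δ → ∀ x ∈ closure Ω, |s t x - s t₀ x| < ε)
    (hsup : ∀ t ∈ Icc (0:ℝ) 1, ∀ x ∈ Ω, smeM m (s t) x ≤ 0)
    (hbdry : ∀ t ∈ Ioc (0:ℝ) 1, ∀ x ∈ frontier Ω, u x < s t x)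
    (hs1 : ∀ x ∈ Ω, u x ≤ s 1 x) :
    ∀ x ∈ Ω, u x ≤ s 0 x := by
  have hKc : IsCompact (closure Ω) := hbdd.isCompact_closure
  have hfr : (frontier Ω).Nonempty := by
    rw [nonempty_frontier_iff]
    refine ⟨hconn.nonempty, fun h => ?_⟩
    have : Nonempty (Fin N) := ⟨⟨0, by omega⟩⟩
    exact NormedSpace.unbounded_univ ℝ (Euc N) (h ▸ hbdd)
  let S : Set ℝ := {t ∈ Icc (0 : ℝ) 1 | ∀ x ∈ Ω, u x ≤ s t x}
  have hS1 : (1 : ℝ) ∈ S := ⟨right_mem_Icc.2 zero_le_one, hs1⟩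
  have hSb : BddBelow S := ⟨0, fun t ht => ht.1.1⟩
  have hT : sInf S ∈ S := by
    have hTI : sInf S ∈ Icc (0 : ℝ) 1 :=
      ⟨le_csInf ⟨1, hS1⟩ fun t ht => ht.1.1, csInf_le hSb hS1⟩
    refine ⟨hTI, fun x hx => le_of_forall_pos_lt_add fun ε hε => ?_⟩
    obtain ⟨δ, hδ, hδs⟩ := hscont _ hTI ε hε
    obtain ⟨t, htS, htlt⟩ := exists_lt_of_csInf_lt ⟨1, hS1⟩ (lt_add_of_pos_right (sInf S) hδ)
    have hle := csInf_le hSb htS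
    have h₁ := hδs t htS.1 (by rw [abs_lt]; constructor <;> linarith) x (subset_closure hx)
    have h₂ := htS.2 x hx
    rw [abs_lt] at h₁
    linarith [h₁.2]
  rcases hT.1.1.eq_or_lt with h0 | hpos
  · rw [h0]
    exact hT.2
  exfalso
  have hTI : sInf S ∈ Ioc (0 : ℝ) 1 := ⟨hpos, hT.1.2⟩
  have hlt := lt_of_smeM_nonpos (by omega) hΩ hconn.isPreconnected (hs2 _ hT.1) hu2 (hs0 _ hT.1)
    hu0 (fun x hx => hupos x (subset_closure hx)) husol (hsup _ hT.1) hT.2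
    (hfr.imp fun x hx => ⟨hx, hbdry _ hTI x hx⟩)
  obtain ⟨x₁, hx₁, hmin⟩ := hKc.exists_isMinOn hconn.nonempty.closure ((hs0 _ hT.1).sub hu0)
  have hε : 0 < s (sInf S) x₁ - u x₁ := by
    rw [sub_pos]
    rw [closure_eq_self_union_frontier] at hx₁
    exact hx₁.elim (hlt x₁) (hbdry _ hTI x₁)
  obtain ⟨δ, hδ, hδs⟩ := hscont _ hT.1 _ hε
  obtain ⟨t, ht0, htT, htδ⟩ : ∃ t, 0 ≤ t ∧ t < sInf S ∧ sInf S - δ < t :=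
    ⟨max 0 (sInf S - δ / 2), le_max_left _ _, max_lt hpos (by linarith),
      lt_max_of_lt_right (by linarith)⟩
  have htI : t ∈ Icc (0 : ℝ) 1 := ⟨ht0, htT.le.trans hT.1.2⟩
  refine htT.not_ge (csInf_le hSb ⟨htI, fun x hx => ?_⟩)
  have h₁ := hδs t htI (by rw [abs_lt]; constructor <;> linarith) x (subset_closure hx)
  have h₂ : s (sInf S) x₁ - u x₁ ≤ s (sInf S) x - u x := hmin (subset_closure hx)
  rw [abs_lt] at h₁
  linarith [h₁.1]
end
end

section
/- The maximal solution φ of the initial value problem is defined on all of (0,∞) (i.e. r₀ = ∞), and for every r > 0 it satisfies: φ''(r) > 0, φ(r) − r·φ'(r) > 0, α₀·r < φ(r) < 1 + α₀·r, and 0 < φ'(r) < α₀. -/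
open Set Filter
open scoped ENNReal Topology

noncomputable section

/-- `α₀ = √((m−1)/(n−1))`. -/
def alpha0 (n m : ℕ) : ℝ := Real.sqrt (((m : ℝ) - 1) / ((n : ℝ) - 1))

/-- `γ = −(n+m−3)/2 + √(((n+m−3)/2)² − (n+m−2))`. -/
def gammaExp (n m : ℕ) : ℝ :=
  -(((n : ℝ) + m - 3) / 2) + Real.sqrt ((((n : ℝ) + m - 3) / 2) ^ 2 - ((n : ℝ) + m - 2))

/-- `φ` is a (positive, twice differentiable) solution of the ODE
`φ''/(1+(φ')²) + ((n'−1)/r)·φ' = (m'−1)/φ` on `(0, r₀)` (with `r₀ ∈ (0,∞]`), subject to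
the initial conditions `φ(r) → 1` and `φ'(r) → 0` as `r ↓ 0`. -/
def IsIVPSolTo (n' m' : ℝ) (φ : ℝ → ℝ) (r₀ : ℝ≥0∞) : Prop :=
  (∀ r : ℝ, 0 < r → ENNReal.ofReal r < r₀ →
      0 < φ r ∧ DifferentiableAt ℝ φ r ∧ DifferentiableAt ℝ (deriv φ) r ∧
        deriv (deriv φ) r / (1 + (deriv φ r) ^ 2) + ((n' - 1) / r) * deriv φ r
          = (m' - 1) / φ r) ∧
  Tendsto φ (𝓝[>] (0 : ℝ)) (𝓝 1) ∧
  Tendsto (deriv φ) (𝓝[>] (0 : ℝ)) (𝓝 0)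

theorem exists_first_zero {f : ℝ → ℝ} {s t : ℝ} (hst : s ≤ t) (hf : ContinuousOn f (Icc s t))
    (hs : 0 < f s) (ht : f t ≤ 0) :
    ∃ r ∈ Ioc s t, f r = 0 ∧ ∀ q ∈ Ico s r, 0 < f q := by
  have hc : IsCompact (Icc s t ∩ f ⁻¹' Iic 0) :=
    isCompact_Icc.of_isClosed_subset (hf.preimage_isClosed_of_isClosed isClosed_Icc isClosed_Iic)
      inter_subset_left
  obtain ⟨r, ⟨hr, hr0⟩, hmin⟩ := hc.exists_isLeast ⟨t, ⟨hst, le_rfl⟩, ht⟩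
  have hpos : ∀ q ∈ Ico s r, 0 < f q := fun q hq => by
    by_contra! h
    exact absurd (hmin ⟨⟨hq.1, hq.2.le.trans hr.2⟩, h⟩) (not_le.2 hq.2)
  have hsr : s < r := lt_of_le_of_ne hr.1 (by rintro rfl; exact absurd hr0 (not_le.2 hs))
  refine ⟨r, ⟨hsr, hr.2⟩, le_antisymm hr0 ?_, hpos⟩
  have hcr : ContinuousWithinAt f (Ico s r) r :=
    (hf r hr).mono (Ico_subset_Icc_self.trans (Icc_subset_Icc_right hr.2))
  have : (𝓝[Ico s r] r).NeBot := by
    rw [← mem_closure_iff_nhdsWithin_neBot, closure_Ico hsr.ne]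
    exact ⟨hsr.le, le_rfl⟩
  exact ge_of_tendsto hcr (eventually_nhdsWithin_of_forall fun q hq => (hpos q hq).le)

theorem deriv_nonpos_of_first_zero {f : ℝ → ℝ} {s r f' : ℝ} (hsr : s < r) (hr : f r = 0)
    (hpos : ∀ q ∈ Ico s r, 0 < f q) (hf : HasDerivAt f f' r) : f' ≤ 0 := by
  have h := (hasDerivWithinAt_iff_tendsto_slope' (s := Iio r) (by simp)).1
    (hf.hasDerivWithinAt (s := Iio r))
  refine le_of_tendsto h ?_
  filter_upwards [Ico_mem_nhdsLT hsr] with q hq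
  rw [slope_def_field, hr]
  exact div_nonpos_of_nonneg_of_nonpos (by simpa using (hpos q hq).le) (by linarith [hq.2])

/-- If `W' > 0` at every zero of `W`, then nonpositivity of `W` propagates backwards. -/
theorem nonpos_of_deriv_pos_at_zeros {W W' : ℝ → ℝ} {s t : ℝ} (hst : s ≤ t)
    (hW : ∀ r ∈ Icc s t, HasDerivAt W (W' r) r)
    (hzero : ∀ r ∈ Icc s t, W r = 0 → 0 < W' r) (ht : W t ≤ 0) : W s ≤ 0 := by
  by_contra! hs
  obtain ⟨r, hr, hr0, hpos⟩ := exists_first_zero hst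
    (fun r hr => (hW r hr).continuousAt.continuousWithinAt) hs ht
  exact absurd (deriv_nonpos_of_first_zero hr.1 hr0 hpos (hW r (Ioc_subset_Icc_self hr)))
    (not_le.2 (hzero r (Ioc_subset_Icc_self hr) hr0))

/-- If `W` tends to `0` at `0` and `W' > 0` wherever `W ≤ 0`, then `W > 0`. -/
theorem pos_of_deriv_pos_of_nonpos {W W' : ℝ → ℝ} {δ : ℝ}
    (hW : ∀ r ∈ Ioo 0 δ, HasDerivAt W (W' r) r)
    (hneg : ∀ r ∈ Ioo 0 δ, W r ≤ 0 → 0 < W' r)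
    (hlim : Tendsto W (𝓝[>] 0) (𝓝 0)) : ∀ r ∈ Ioo 0 δ, 0 < W r := by
  intro r hr
  by_contra! hr0
  have hsub : ∀ s ∈ Ioc 0 r, s ∈ Ioo 0 δ := fun s hs => ⟨hs.1, hs.2.trans_lt hr.2⟩
  have hall : ∀ s ∈ Ioc 0 r, W s ≤ 0 := fun s hs =>
    nonpos_of_deriv_pos_at_zeros hs.2
      (fun q hq => hW q (hsub q ⟨hs.1.trans_le hq.1, hq.2⟩))
      (fun q hq hq0 => hneg q (hsub q ⟨hs.1.trans_le hq.1, hq.2⟩) hq0.le) hr0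
  have hmono : StrictMonoOn W (Ioc 0 r) := by
    refine strictMonoOn_of_deriv_pos (convex_Ioc 0 r)
      (fun q hq => (hW q (hsub q hq)).continuousAt.continuousWithinAt) fun q hq => ?_
    have hq' := interior_subset hq
    rw [(hW q (hsub q hq')).deriv]
    exact hneg q (hsub q hq') (hall q hq')
  have hr2 : r / 2 ∈ Ioc 0 r := ⟨by linarith [hr.1], by linarith [hr.1]⟩
  have h1 : W (r / 2) < W r := hmono hr2 ⟨hr.1, le_rfl⟩ (by linarith [hr.1])
  have h2 : 0 ≤ W (r / 2) := by
    refine le_of_tendsto hlim ?_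
    filter_upwards [Ioo_mem_nhdsGT hr2.1] with q hq
    exact hmono.monotoneOn ⟨hq.1, hq.2.le.trans hr2.2⟩ hr2 hq.2.le
  linarith

/-- Solutions of the profile equation on `(0, T)`, written as a first order system, with
`a = n - 1` and `b = m - 1`. -/
structure IsProfile (a b T : ℝ) (f p : ℝ → ℝ) : Prop where
  pos : ∀ r ∈ Ioo 0 T, 0 < f r
  hasDerivAt : ∀ r ∈ Ioo 0 T, HasDerivAt f (p r) r
  hasDerivAt_slope : ∀ r ∈ Ioo 0 T,
    HasDerivAt p ((1 + p r ^ 2) * (b / f r - a * p r / r)) r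
  tendsto : Tendsto f (𝓝[>] 0) (𝓝 1)
  tendsto_slope : Tendsto p (𝓝[>] 0) (𝓝 0)

theorem tendsto_id_nhdsGT_zero : Tendsto (fun r : ℝ => r) (𝓝[>] 0) (𝓝 0) :=
  tendsto_id.mono_left nhdsWithin_le_nhds

namespace IsProfile

variable {a b T α : ℝ} {f p : ℝ → ℝ}

theorem eventually_linear_lt (h : IsProfile a b T f p) (hT : 0 < T) (ha : 0 ≤ a) {κ : ℝ}
    (hκ : 0 ≤ κ) (hκb : (a + 1) * κ < b) : ∀ᶠ r in 𝓝[>] 0, κ * r < p r := by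
  have hlim : Tendsto (fun r => b / f r - a * κ) (𝓝[>] 0) (𝓝 (b / 1 - a * κ)) :=
    (tendsto_const_nhds.div h.tendsto one_ne_zero).sub tendsto_const_nhds
  have hev : ∀ᶠ r in 𝓝[>] 0, κ < b / f r - a * κ :=
    hlim.eventually (lt_mem_nhds (by linarith))
  obtain ⟨δ, hδ, hδ'⟩ := (mem_nhdsGT_iff_exists_Ioo_subset' hT).1
    (hev.and (Ioo_mem_nhdsGT hT))
  have hW := pos_of_deriv_pos_of_nonpos (W := fun r => p r - κ * r) (δ := δ)
    (W' := fun r => (1 + p r ^ 2) * (b / f r - a * p r / r) - κ * 1)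
    (fun r hr => (h.hasDerivAt_slope r (hδ' hr).2).sub ((hasDerivAt_id r).const_mul κ))
    (fun r hr hr0 => by
      have h1 : κ < b / f r - a * κ := (hδ' hr).1
      have h2 : a * p r / r ≤ a * κ := by
        rw [div_le_iff₀ hr.1]
        nlinarith
      nlinarith [sq_nonneg (p r)])
    (by simpa using h.tendsto_slope.sub (tendsto_id_nhdsGT_zero.const_mul κ))
  filter_upwards [Ioo_mem_nhdsGT hδ] with r hr
  linarith [hW r hr]

theorem hasDerivAt_ratio (h : IsProfile a b T f p) {r : ℝ} (hr : r ∈ Ioo 0 T) :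
    HasDerivAt (fun s => α * s / f s) ((α * f r - α * r * p r) / f r ^ 2) r := by
  have := ((hasDerivAt_id r).const_mul α).div (h.hasDerivAt r hr) (h.pos r hr).ne'
  exact this.congr_deriv (by simp)

theorem tendsto_ratio (h : IsProfile a b T f p) :
    Tendsto (fun s => α * s / f s) (𝓝[>] 0) (𝓝 0) := by
  have := (tendsto_id_nhdsGT_zero.const_mul α).div h.tendsto one_ne_zero
  rwa [mul_zero, zero_div] at this

end IsProfile

theorem barrier_polynomial_pos {x : ℝ} (h0 : 0 ≤ x) (h1 : x ≤ 1) :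
    0 < 1 + x + 5 / 2 * x ^ 2 - 7 / 2 * x ^ 3 - 7 / 2 * x ^ 4 + x ^ 8 + x ^ 9 + x ^ 10 := by
  nlinarith [mul_nonneg h0 (sub_nonneg.2 h1), pow_nonneg h0 2, pow_nonneg h0 3,
    sq_nonneg (x ^ 4 - 4 * x / 5), sq_nonneg (x ^ 5 - x ^ 2), sq_nonneg (x ^ 4 - x ^ 2),
    sq_nonneg (x - 1), sq_nonneg (x ^ 2 - x)]

/-- The curve `p = α (x + x⁴) / 2` is a strict subsolution in the phase plane. -/
theorem barrier_strict {a b x y : ℝ} (ha : 2 ≤ a) (hab : 6 ≤ a + b) (h0 : 0 < x) (h1 : x < 1)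
    (hy : y = (x + x ^ 4) / 2) :
    (1 + 4 * x ^ 3) / 2 * x * (1 - x * y) < (a + b * y ^ 2) * (x - y) := by
  have hx4 : x ^ 4 < x := by nlinarith [pow_lt_one₀ h0.le h1 (n := 3) (by norm_num)]
  have hy0 : 0 < y := by rw [hy]; positivity
  have hyx : y < x := by linarith
  have hcoef : 2 + 4 * y ^ 2 ≤ a + b * y ^ 2 := by
    nlinarith [mul_nonneg (sub_nonneg.2 ha) (by nlinarith : (0:ℝ) ≤ 1 - y ^ 2),
      mul_nonneg (sub_nonneg.2 hab) (sq_nonneg y)]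
  refine lt_of_lt_of_le ?_ (mul_le_mul_of_nonneg_right hcoef (sub_pos.2 hyx).le)
  have hq := mul_pos (mul_pos h0 (sub_pos.2 h1)) (barrier_polynomial_pos h0.le h1.le)
  subst hy
  nlinarith

namespace IsProfile

variable {a b T α : ℝ} {f p : ℝ → ℝ}

theorem barrier_pos (h : IsProfile a b T f p) (ha : 2 ≤ a) (hab : 6 ≤ a + b)
    (hα : 0 < α) (hb : b = a * α ^ 2) {t : ℝ} (ht : t ∈ Ioo 0 T) :
    α * t < f t ∧ α * (α * t / f t + (α * t / f t) ^ 4) / 2 < p t := by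
  set x : ℝ → ℝ := fun r => α * r / f r with hx
  set D : ℝ → ℝ := fun r => f r - α * r with hD
  set E : ℝ → ℝ := fun r => p r - α * (x r + x r ^ 4) / 2 with hE
  set E' : ℝ → ℝ := fun r => (1 + p r ^ 2) * (b / f r - a * p r / r)
    - α * (1 + 4 * x r ^ 3) / 2 * ((α * f r - α * r * p r) / f r ^ 2) with hE'
  have hx' : ∀ r ∈ Ioo 0 T, HasDerivAt x ((α * f r - α * r * p r) / f r ^ 2) r :=
    fun r hr => h.hasDerivAt_ratio hr
  have hDd : ∀ r ∈ Ioo 0 T, HasDerivAt D (p r - α) r := fun r hr =>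
    ((h.hasDerivAt r hr).sub ((hasDerivAt_id r).const_mul α)).congr_deriv (by simp)
  have hEd : ∀ r ∈ Ioo 0 T, HasDerivAt E (E' r) r := fun r hr => by
    have := (h.hasDerivAt_slope r hr).sub
      ((((hx' r hr).add ((hx' r hr).pow 4)).const_mul α).div_const 2)
    refine this.congr_deriv ?_
    simp only [hE']
    push_cast
    ring
  have hxlim : Tendsto x (𝓝[>] 0) (𝓝 0) := h.tendsto_ratio
  have hT : 0 < T := ht.1.trans ht.2
  have hstart : ∀ᶠ r in 𝓝[>] 0, 0 < D r ∧ 0 < E r := by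
    have h1 : ∀ᶠ r in 𝓝[>] 0, 3 / 5 * α ^ 2 * r < p r :=
      h.eventually_linear_lt hT (by linarith) (by positivity) (by
        rw [hb]; nlinarith [pow_pos hα 2])
    have h2 : ∀ᶠ r in 𝓝[>] 0, α ^ 2 * (1 + x r ^ 3) / (2 * f r) < 3 / 5 * α ^ 2 := by
      have : Tendsto (fun r => α ^ 2 * (1 + x r ^ 3) / (2 * f r)) (𝓝[>] 0)
          (𝓝 (α ^ 2 * (1 + 0 ^ 3) / (2 * 1))) :=
        (((hxlim.pow 3).const_add 1).const_mul _).div (h.tendsto.const_mul 2) (by norm_num)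
      exact this.eventually (gt_mem_nhds (by nlinarith [pow_pos hα 2]))
    have h3 : ∀ᶠ r in 𝓝[>] 0, 0 < D r := by
      have : Tendsto D (𝓝[>] 0) (𝓝 (1 - α * 0)) :=
        h.tendsto.sub (tendsto_id_nhdsGT_zero.const_mul α)
      exact this.eventually (lt_mem_nhds (by norm_num))
    filter_upwards [h1, h2, h3, Ioo_mem_nhdsGT hT] with r h1 h2 h3 hr
    refine ⟨h3, ?_⟩
    have hf := h.pos r hr
    have : α * (x r + x r ^ 4) / 2 = α ^ 2 * (1 + x r ^ 3) / (2 * f r) * r := by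
      simp only [hx]
      field_simp
    have h4 := mul_lt_mul_of_pos_right h2 hr.1
    simp only [hE]
    linarith
  obtain ⟨s, ⟨hDs, hEs⟩, hs⟩ := (hstart.and (Ioo_mem_nhdsGT ht.1)).exists
  have hsub : ∀ r ∈ Icc s t, r ∈ Ioo 0 T := fun r hr =>
    ⟨hs.1.trans_le hr.1, hr.2.trans_lt ht.2⟩
  suffices hmin : 0 < min (D t) (E t) by
    rw [lt_min_iff] at hmin
    exact ⟨sub_pos.1 hmin.1, sub_pos.1 hmin.2⟩
  by_contra! hcon
  obtain ⟨r, hr, hr0, hpos⟩ := exists_first_zero (f := fun r => min (D r) (E r)) hs.2.le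
    (fun q hq => ContinuousAt.continuousWithinAt ((hDd q (hsub q hq)).continuousAt.min
      (hEd q (hsub q hq)).continuousAt)) (lt_min hDs hEs) hcon
  have hrT := hsub r (Ioc_subset_Icc_self hr)
  have hsr : ∀ q ∈ Icc s r, q ∈ Ioo 0 T := fun q hq => hsub q ⟨hq.1, hq.2.trans hr.2⟩
  have hnn : ∀ q ∈ Icc s r, 0 ≤ D q ∧ 0 ≤ E q := fun q hq => by
    have : 0 ≤ min (D q) (E q) := by
      rcases hq.2.lt_or_eq with hlt | rfl
      · exact (hpos q ⟨hq.1, hlt⟩).le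
      · exact hr0.ge
    exact le_min_iff.1 this
  have hDr : 0 < D r := by
    have hder : ∀ q ∈ Icc s r, HasDerivAt (fun q => q ^ 3 * D q)
        (3 * q ^ 2 * D q + q ^ 3 * (p q - α)) q := fun q hq =>
      ((hasDerivAt_pow 3 q).mul (hDd q (hsr q hq))).congr_deriv (by simp)
    have hmono : MonotoneOn (fun q => q ^ 3 * D q) (Icc s r) := by
      refine monotoneOn_of_deriv_nonneg (convex_Icc s r)
        (fun q hq => (hder q hq).continuousAt.continuousWithinAt)
        (fun q hq => (hder q (interior_subset hq)).differentiableAt.differentiableWithinAt)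
        fun q hq => ?_
      have hq' := interior_subset hq
      rw [(hder q hq').deriv]
      have hq0 := (hsr q hq').1
      have hfq := h.pos q (hsr q hq')
      obtain ⟨hDq, hEq⟩ := hnn q hq'
      have hxq : x q * f q = α * q := by simp only [hx]; field_simp
      have hxq0 : 0 < x q := by simp only [hx]; positivity
      have hxq1 : x q ≤ 1 := by
        simp only [hx]; rw [div_le_one hfq]; simp only [hD] at hDq; linarith
      have hbern : 4 * x q - 3 ≤ x q ^ 4 := by
        nlinarith [sq_nonneg (x q ^ 2 - 1), sq_nonneg (x q - 1)]
      have hslope : α * (5 * x q - 3) / 2 ≤ p q := by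
        simp only [hE] at hEq
        nlinarith
      have hDx : D q = f q * (1 - x q) := by simp only [hD]; linarith
      have hqD : α * q * (1 - x q) ≤ D q := by
        rw [hDx, ← hxq]
        nlinarith [mul_nonneg (mul_nonneg hfq.le (sub_nonneg.2 hxq1)) (sub_nonneg.2 hxq1)]
      have : 0 ≤ 3 * D q + q * (p q - α) := by nlinarith
      nlinarith [mul_nonneg (sq_nonneg q) this]
    have := hmono ⟨le_rfl, hr.1.le⟩ ⟨hr.1.le, le_rfl⟩ hr.1.le
    have h1 : 0 < s ^ 3 * D s := mul_pos (pow_pos hs.1 3) hDs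
    exact pos_of_mul_pos_right (h1.trans_le this) (pow_pos hrT.1 3).le
  have hEr : E r = 0 := by
    rcases min_choice (D r) (E r) with h' | h' <;> rw [h'] at hr0
    · exact absurd hr0 hDr.ne'
    · exact hr0
  have hle := deriv_nonpos_of_first_zero hr.1 hEr
    (fun q hq => (lt_min_iff.1 (hpos q hq)).2) (hEd r hrT)
  have hf := h.pos r hrT
  have hx0 : 0 < x r := div_pos (mul_pos hα hrT.1) hf
  have hx1 : x r < 1 := by
    simp only [hx]; rw [div_lt_one hf]; simp only [hD] at hDr; linarith
  have hlt := barrier_strict ha hab hx0 hx1 rfl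
  have hfr : f r = α * r / x r := by
    simp only [hx]; field_simp [hrT.1.ne']
  have hpr : p r = α * ((x r + x r ^ 4) / 2) := by simp only [hE] at hEr; linarith
  have hkey : E' r = α / r * ((a + b * ((x r + x r ^ 4) / 2) ^ 2) * (x r - (x r + x r ^ 4) / 2)
      - (1 + 4 * x r ^ 3) / 2 * x r * (1 - x r * ((x r + x r ^ 4) / 2))) := by
    have hr' := hrT.1.ne'
    simp only [hE']
    rw [hfr, hpr, hb]
    generalize (x r + x r ^ 4) / 2 = y
    generalize x r = z at hx0
    field_simp
  rw [hkey] at hle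
  exact absurd hle (not_le.2 (mul_pos (div_pos hα hrT.1) (sub_pos.2 hlt)))

theorem slope_pos (h : IsProfile a b T f p) (ha : 2 ≤ a) (hab : 6 ≤ a + b)
    (hα : 0 < α) (hb : b = a * α ^ 2) {t : ℝ} (ht : t ∈ Ioo 0 T) : 0 < p t := by
  have hf := h.pos t ht
  have ht0 := ht.1
  refine lt_trans ?_ (h.barrier_pos ha hab hα hb ht).2
  positivity

theorem slope_lt_ratio (h : IsProfile a b T f p) (ha : 2 ≤ a) (hab : 6 ≤ a + b)
    (hα : 0 < α) (hb : b = a * α ^ 2) {t : ℝ} (ht : t ∈ Ioo 0 T) :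
    p t < α * (α * t / f t) := by
  by_contra! hcon
  have hsub : ∀ r ∈ Ioc 0 t, r ∈ Ioo 0 T := fun r hr => ⟨hr.1, hr.2.trans_lt ht.2⟩
  have hall : ∀ s ∈ Ioc 0 t, α * (α * s / f s) - p s ≤ 0 := fun s hs => by
    have hsub' : ∀ r ∈ Icc s t, r ∈ Ioo 0 T := fun r hr =>
      hsub r ⟨hs.1.trans_le hr.1, hr.2⟩
    refine nonpos_of_deriv_pos_at_zeros (W := fun s => α * (α * s / f s) - p s) hs.2
      (fun r hr => ((h.hasDerivAt_ratio (hsub' r hr)).const_mul α).sub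
        (h.hasDerivAt_slope r (hsub' r hr))) (fun r hr hr0 => ?_) (by linarith)
    have hr' := hsub' r hr
    have hf := h.pos r hr'
    have hr0' := hr'.1
    have hpr : p r = α * (α * r / f r) := by linarith
    have hzero : b / f r - a * p r / r = 0 := by
      rw [hpr, hb]
      field_simp
      ring
    have hlt : α * r < f r := (h.barrier_pos ha hab hα hb hr').1
    have hprα : p r < α := by
      rw [hpr]
      exact mul_lt_of_lt_one_right hα ((div_lt_one hf).2 hlt)
    rw [hzero, mul_zero, sub_zero]
    refine mul_pos hα (div_pos ?_ (by positivity))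
    nlinarith [mul_pos hα (sub_pos.2 hlt), mul_pos (mul_pos hα hr0') (sub_pos.2 hprα)]
  have hanti : AntitoneOn p (Ioc 0 t) := by
    refine antitoneOn_of_deriv_nonpos (convex_Ioc 0 t)
      (fun q hq => (h.hasDerivAt_slope q (hsub q hq)).continuousAt.continuousWithinAt)
      (fun q hq => (h.hasDerivAt_slope q
        (hsub q (interior_subset hq))).differentiableAt.differentiableWithinAt) fun q hq => ?_
    have hq' := interior_subset hq
    have hf := h.pos q (hsub q hq')
    have hq0 := hq'.1
    rw [(h.hasDerivAt_slope q (hsub q hq')).deriv]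
    refine mul_nonpos_of_nonneg_of_nonpos (by positivity) ?_
    have h1 := hall q hq'
    have h2 : b / f q = a * (α * (α * q / f q)) / q := by
      rw [hb]
      field_simp
    rw [h2, ← sub_div, ← mul_sub]
    exact div_nonpos_of_nonpos_of_nonneg
      (mul_nonpos_of_nonneg_of_nonpos (by linarith) h1) hq0.le
  have : p t ≤ 0 := by
    refine ge_of_tendsto h.tendsto_slope ?_
    filter_upwards [Ioo_mem_nhdsGT ht.1] with q hq
    exact hanti ⟨hq.1, hq.2.le⟩ ⟨ht.1, le_rfl⟩ hq.2.le
  exact absurd (h.slope_pos ha hab hα hb ht) (not_lt.2 this)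

theorem slope_lt (h : IsProfile a b T f p) (ha : 2 ≤ a) (hab : 6 ≤ a + b)
    (hα : 0 < α) (hb : b = a * α ^ 2) {t : ℝ} (ht : t ∈ Ioo 0 T) : p t < α :=
  (h.slope_lt_ratio ha hab hα hb ht).trans (mul_lt_of_lt_one_right hα
    ((div_lt_one (h.pos t ht)).2 (h.barrier_pos ha hab hα hb ht).1))

theorem second_deriv_pos (h : IsProfile a b T f p) (ha : 2 ≤ a) (hab : 6 ≤ a + b)
    (hα : 0 < α) (hb : b = a * α ^ 2) {t : ℝ} (ht : t ∈ Ioo 0 T) :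
    0 < (1 + p t ^ 2) * (b / f t - a * p t / t) := by
  have hf := h.pos t ht
  have ht0 := ht.1
  have h1 := h.slope_lt_ratio ha hab hα hb ht
  have h2 : b / f t = a * (α * (α * t / f t)) / t := by
    rw [hb]
    field_simp
  rw [h2, ← sub_div, ← mul_sub]
  exact mul_pos (by positivity) (div_pos (mul_pos (by linarith) (sub_pos.2 h1)) ht0)

theorem sub_mul_slope_pos (h : IsProfile a b T f p) (ha : 2 ≤ a) (hab : 6 ≤ a + b)
    (hα : 0 < α) (hb : b = a * α ^ 2) {t : ℝ} (ht : t ∈ Ioo 0 T) : 0 < f t - t * p t := by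
  nlinarith [(h.barrier_pos ha hab hα hb ht).1, h.slope_lt ha hab hα hb ht, ht.1]

theorem lt_one_add (h : IsProfile a b T f p) (ha : 2 ≤ a) (hab : 6 ≤ a + b)
    (hα : 0 < α) (hb : b = a * α ^ 2) {t : ℝ} (ht : t ∈ Ioo 0 T) : f t < 1 + α * t := by
  have hlim : Tendsto (fun r => 1 + α * r - f r) (𝓝[>] 0) (𝓝 0) := by
    simpa using ((tendsto_id_nhdsGT_zero.const_mul α).const_add 1).sub h.tendsto
  have := pos_of_deriv_pos_of_nonpos (W := fun r => 1 + α * r - f r) (W' := fun r => α - p r)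
    (δ := T) (fun r hr =>
      ((((hasDerivAt_id r).const_mul α).const_add 1).sub (h.hasDerivAt r hr)).congr_deriv
        (by simp))
    (fun r hr _ => sub_pos.2 (h.slope_lt ha hab hα hb hr)) hlim t ht
  linarith

end IsProfile

theorem hasDerivAt_ite_lt {f f' g g' : ℝ → ℝ} {T ε : ℝ} (hT : 0 < T) (hε : 0 < ε)
    (hf : ∀ r ∈ Ioo 0 T, HasDerivAt f (f' r) r)
    (hg : ∀ r ∈ Ioo (T - ε) (T + ε), HasDerivAt g (g' r) r)
    (hlim : Tendsto f (𝓝[<] T) (𝓝 (g T))) (hlim' : Tendsto f' (𝓝[<] T) (𝓝 (g' T))) :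
    ∀ r ∈ Ioo 0 (T + ε), HasDerivAt (fun r => if r < T then f r else g r)
      (if r < T then f' r else g' r) r := by
  set F : ℝ → ℝ := fun r => if r < T then f r else g r with hF
  have hFf : ∀ r, r < T → F r = f r := fun r hr => if_pos hr
  have hFg : ∀ r, T ≤ r → F r = g r := fun r hr => if_neg (not_lt.2 hr)
  have hleft : ∀ r ∈ Ioo 0 T, HasDerivAt F (f' r) r := fun r hr =>
    (hf r hr).congr_of_eventuallyEq (mem_of_superset (Iio_mem_nhds hr.2) fun s hs => hFf s hs)
  intro r hr
  rcases lt_trichotomy r T with hlt | rfl | hgt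
  · rw [if_pos hlt]
    exact hleft r ⟨hr.1, hlt⟩
  · rw [if_neg (lt_irrefl r)]
    have hgr := hg r ⟨by linarith, by linarith⟩
    have hright : HasDerivWithinAt F (g' r) (Ici r) r :=
      hgr.hasDerivWithinAt.congr (fun s hs => hFg s hs) (hFg r le_rfl)
    have hIic : HasDerivWithinAt F (g' r) (Iic r) r := by
      refine hasDerivWithinAt_Iic_of_tendsto_deriv (s := Ioo 0 r)
        (fun s hs => (hleft s hs).differentiableAt.differentiableWithinAt) ?_
        (Ioo_mem_nhdsLT hT) ?_
      · rw [ContinuousWithinAt, hFg r le_rfl]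
        refine ((hlim.mono_left (nhdsWithin_mono r fun s hs => hs.2))).congr' ?_
        filter_upwards [self_mem_nhdsWithin] with s hs
        exact (hFf s hs.2).symm
      · refine hlim'.congr' ?_
        filter_upwards [Ioo_mem_nhdsLT hT] with s hs
        exact (hleft s hs).deriv.symm
    have := hIic.union hright
    rwa [Iic_union_Ici, hasDerivWithinAt_univ] at this
  · rw [if_neg hgt.not_gt]
    exact (hg r ⟨by linarith, hr.2⟩).congr_of_eventuallyEq
      (mem_of_superset (Ioi_mem_nhds hgt) fun s hs => hFg s (le_of_lt hs))

/-- Local solvability of the profile equation away from `r = 0` and `f = 0`. -/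
theorem exists_local_profile (a b : ℝ) {T u₀ v₀ : ℝ} (hT : 0 < T) (hu₀ : 0 < u₀) :
    ∃ ε > 0, ∃ u v : ℝ → ℝ, u T = u₀ ∧ v T = v₀ ∧ ∀ r ∈ Ioo (T - ε) (T + ε),
      0 < u r ∧ HasDerivAt u (v r) r ∧
        HasDerivAt v ((1 + v r ^ 2) * (b / u r - a * v r / r)) r := by
  set X : ℝ × ℝ × ℝ → ℝ × ℝ × ℝ := fun z =>
    (1, z.2.2, (1 + z.2.2 ^ 2) * (b / z.2.1 - a * z.2.2 / z.1)) with hX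
  have hXd : ContDiffAt ℝ 1 X (T, u₀, v₀) := by
    have h1 : ContDiffAt ℝ 1 (fun z : ℝ × ℝ × ℝ => z.1) (T, u₀, v₀) := contDiffAt_fst
    have h2 : ContDiffAt ℝ 1 (fun z : ℝ × ℝ × ℝ => z.2.1) (T, u₀, v₀) :=
      contDiff_snd.fst.contDiffAt
    have h3 : ContDiffAt ℝ 1 (fun z : ℝ × ℝ × ℝ => z.2.2) (T, u₀, v₀) :=
      contDiff_snd.snd.contDiffAt
    exact contDiffAt_const.prodMk (h3.prodMk ((contDiffAt_const.add (h3.pow 2)).mul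
      ((contDiffAt_const.div h2 hu₀.ne').sub ((contDiffAt_const.mul h3).div h1 hT.ne'))))
  obtain ⟨ρ, hρ, ε, hε, hsol⟩ :=
    hXd.exists_forall_mem_closedBall_exists_eq_forall_mem_Ioo_hasDerivAt T
  obtain ⟨z, hz0, hz⟩ := hsol _ (Metric.mem_closedBall_self hρ.le)
  have hz1 : ∀ r ∈ Ioo (T - ε) (T + ε), HasDerivAt (fun s => (z s).1) 1 r :=
    fun r hr => (hz r hr).fst
  have hz2 : ∀ r ∈ Ioo (T - ε) (T + ε), HasDerivAt (fun s => (z s).2.1) (z r).2.2 r :=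
    fun r hr => (hz r hr).snd.fst
  have hz3 : ∀ r ∈ Ioo (T - ε) (T + ε), HasDerivAt (fun s => (z s).2.2)
      ((1 + (z r).2.2 ^ 2) * (b / (z r).2.1 - a * (z r).2.2 / (z r).1)) r :=
    fun r hr => (hz r hr).snd.snd
  have hTmem : T ∈ Ioo (T - ε) (T + ε) := ⟨by linarith, by linarith⟩
  have htime : ∀ r ∈ Ioo (T - ε) (T + ε), (z r).1 = r := fun r hr => by
    have hd : ∀ s ∈ Ioo (T - ε) (T + ε), HasDerivAt (fun s => (z s).1 - s) 0 s := fun s hs =>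
      ((hz1 s hs).sub (hasDerivAt_id s)).congr_deriv (sub_self 1)
    have := isOpen_Ioo.is_const_of_deriv_eq_zero isPreconnected_Ioo
      (fun s hs => (hd s hs).differentiableAt.differentiableWithinAt)
      (fun s hs => (hd s hs).deriv) hr hTmem
    simp only [hz0, sub_self] at this
    linarith
  have hpos : ∀ᶠ r in 𝓝 T, 0 < (z r).2.1 :=
    (hz2 T hTmem).continuousAt.eventually (lt_mem_nhds (by simpa [hz0] using hu₀))
  obtain ⟨η, hη, hηpos⟩ := Metric.eventually_nhds_iff_ball.1 hpos
  refine ⟨min ε η, lt_min hε hη, fun s => (z s).2.1, fun s => (z s).2.2, by simp [hz0],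
    by simp [hz0], fun r hr => ?_⟩
  have hrε : r ∈ Ioo (T - ε) (T + ε) :=
    ⟨by linarith [hr.1, min_le_left ε η], by linarith [hr.2, min_le_left ε η]⟩
  refine ⟨hηpos r ?_, hz2 r hrε, ?_⟩
  · rw [Real.ball_eq_Ioo]
    exact ⟨by linarith [hr.1, min_le_right ε η], by linarith [hr.2, min_le_right ε η]⟩
  · have := hz3 r hrε
    rwa [htime r hrε] at this

namespace IsProfile

variable {a b T α : ℝ} {f p : ℝ → ℝ}

theorem exists_extension (h : IsProfile a b T f p) (hT : 0 < T) (ha : 2 ≤ a)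
    (hab : 6 ≤ a + b) (hα : 0 < α) (hb : b = a * α ^ 2) :
    ∃ T' > T, ∃ g q, IsProfile a b T' g q := by
  have hfmono : MonotoneOn f (Ioo 0 T) := by
    refine monotoneOn_of_deriv_nonneg (convex_Ioo 0 T)
      (fun r hr => (h.hasDerivAt r hr).continuousAt.continuousWithinAt)
      (fun r hr => (h.hasDerivAt r
        (interior_subset hr)).differentiableAt.differentiableWithinAt) fun r hr => ?_
    rw [(h.hasDerivAt r (interior_subset hr)).deriv]
    exact (h.slope_pos ha hab hα hb (interior_subset hr)).le
  have hpmono : MonotoneOn p (Ioo 0 T) := by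
    refine monotoneOn_of_deriv_nonneg (convex_Ioo 0 T)
      (fun r hr => (h.hasDerivAt_slope r hr).continuousAt.continuousWithinAt)
      (fun r hr => (h.hasDerivAt_slope r
        (interior_subset hr)).differentiableAt.differentiableWithinAt) fun r hr => ?_
    rw [(h.hasDerivAt_slope r (interior_subset hr)).deriv]
    exact (h.second_deriv_pos ha hab hα hb (interior_subset hr)).le
  obtain ⟨u₀, hfu⟩ : ∃ u₀, Tendsto f (𝓝[<] T) (𝓝 u₀) :=
    ⟨_, hfmono.tendsto_nhdsWithin_Ioo_left (nonempty_Ioo.2 hT) ⟨1 + α * T, by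
      rintro _ ⟨r, hr, rfl⟩
      nlinarith [h.lt_one_add ha hab hα hb hr, hr.2]⟩⟩
  obtain ⟨v₀, hpv⟩ : ∃ v₀, Tendsto p (𝓝[<] T) (𝓝 v₀) :=
    ⟨_, hpmono.tendsto_nhdsWithin_Ioo_left (nonempty_Ioo.2 hT) ⟨α, by
      rintro _ ⟨r, hr, rfl⟩
      exact (h.slope_lt ha hab hα hb hr).le⟩⟩
  have hid : Tendsto (fun r : ℝ => r) (𝓝[<] T) (𝓝 T) := tendsto_id.mono_left nhdsWithin_le_nhds
  have hu₀ : 0 < u₀ := by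
    refine (mul_pos hα hT).trans_le (le_of_tendsto_of_tendsto (hid.const_mul α) hfu ?_)
    filter_upwards [Ioo_mem_nhdsLT hT] with r hr
    exact (h.barrier_pos ha hab hα hb hr).1.le
  obtain ⟨ε, hε, u, v, hu, hv, huv⟩ := exists_local_profile a b (v₀ := v₀) hT hu₀
  have hd1 := hasDerivAt_ite_lt hT hε h.hasDerivAt (fun r hr => (huv r hr).2.1)
    (by rwa [hu]) (by rwa [hv])
  have hd2 := hasDerivAt_ite_lt hT hε h.hasDerivAt_slope (fun r hr => (huv r hr).2.2)
    (by rwa [hv]) (by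
      rw [hu, hv]
      exact ((hpv.pow 2).const_add 1).mul ((tendsto_const_nhds.div hfu hu₀.ne').sub
        ((hpv.const_mul a).div hid hT.ne')))
  refine ⟨T + ε, by linarith, fun r => if r < T then f r else u r,
    fun r => if r < T then p r else v r, fun r hr => ?_, hd1, fun r hr => ?_, ?_, ?_⟩
  · split_ifs with hlt
    · exact h.pos r ⟨hr.1, hlt⟩
    · exact (huv r ⟨by linarith, hr.2⟩).1
  · refine (hd2 r hr).congr_deriv ?_
    split_ifs <;> rfl
  · refine h.tendsto.congr' ?_
    filter_upwards [Ioo_mem_nhdsGT hT] with r hr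
    exact (if_pos hr.2).symm
  · refine h.tendsto_slope.congr' ?_
    filter_upwards [Ioo_mem_nhdsGT hT] with r hr
    exact (if_pos hr.2).symm

theorem isIVPSolTo {n m : ℝ} (h : IsProfile (n - 1) (m - 1) T f p) (hT : 0 < T) :
    IsIVPSolTo n m f (ENNReal.ofReal T) := by
  have hderiv : ∀ r ∈ Ioo 0 T, deriv f r = p r := fun r hr => (h.hasDerivAt r hr).deriv
  have hderiv2 : ∀ r ∈ Ioo 0 T, HasDerivAt (deriv f)
      ((1 + p r ^ 2) * ((m - 1) / f r - (n - 1) * p r / r)) r := fun r hr =>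
    (h.hasDerivAt_slope r hr).congr_of_eventuallyEq
      (mem_of_superset (Ioo_mem_nhds hr.1 hr.2) fun s hs => hderiv s hs)
  refine ⟨fun r hr0 hrT => ?_, h.tendsto, h.tendsto_slope.congr' ?_⟩
  · have hr : r ∈ Ioo 0 T := ⟨hr0, (ENNReal.ofReal_lt_ofReal_iff hT).1 hrT⟩
    refine ⟨h.pos r hr, (h.hasDerivAt r hr).differentiableAt, (hderiv2 r hr).differentiableAt, ?_⟩
    rw [(hderiv2 r hr).deriv, hderiv r hr, mul_div_cancel_left₀ _ (by positivity)]
    ring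
  · filter_upwards [Ioo_mem_nhdsGT hT] with r hr
    exact (hderiv r hr).symm

end IsProfile

theorem IsIVPSolTo.isProfile {n m T : ℝ} {φ : ℝ → ℝ} {r₀ : ℝ≥0∞} (h : IsIVPSolTo n m φ r₀)
    (hT : ENNReal.ofReal T ≤ r₀) : IsProfile (n - 1) (m - 1) T φ (deriv φ) := by
  have hr₀ : ∀ r ∈ Ioo 0 T, ENNReal.ofReal r < r₀ := fun r hr =>
    ((ENNReal.ofReal_lt_ofReal_iff (hr.1.trans hr.2)).2 hr.2).trans_le hT
  refine ⟨fun r hr => (h.1 r hr.1 (hr₀ r hr)).1,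
    fun r hr => (h.1 r hr.1 (hr₀ r hr)).2.1.hasDerivAt, fun r hr => ?_, h.2.1, h.2.2⟩
  obtain ⟨-, -, hd, hode⟩ := h.1 r hr.1 (hr₀ r hr)
  refine hd.hasDerivAt.congr_deriv ?_
  have hne : 1 + deriv φ r ^ 2 ≠ 0 := by positivity
  rw [← hode]
  field_simp
  ring

/-- The maximal solution `φ` of the IVP
`φ''/(1+(φ')²) + ((n−1)/r)φ' = (m−1)/φ`, `φ(0⁺)=1`, `φ'(0⁺)=0` is defined on all of
`(0,∞)`, and for every `r > 0`: `φ''(r) > 0`, `φ(r) − rφ'(r) > 0`,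
`α₀r < φ(r) < 1 + α₀r`, and `0 < φ'(r) < α₀`. -/
theorem radial_profile_properties
    (n m ℓ : ℕ) (hn : 3 ≤ n) (hm : 2 ≤ m) (hl : 1 ≤ ℓ) (hnm : 8 ≤ n + m)
    (φ : ℝ → ℝ) (r₀ : ℝ≥0∞) (hr₀ : 0 < r₀)
    (hφ : IsIVPSolTo (n : ℝ) (m : ℝ) φ r₀)
    (hmax : ∀ (ψ : ℝ → ℝ) (r₁ : ℝ≥0∞), IsIVPSolTo (n : ℝ) (m : ℝ) ψ r₁ → r₁ ≤ r₀) :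
    r₀ = ⊤ ∧ ∀ r : ℝ, 0 < r →
      0 < deriv (deriv φ) r ∧ 0 < φ r - r * deriv φ r ∧
      alpha0 n m * r < φ r ∧ φ r < 1 + alpha0 n m * r ∧
      0 < deriv φ r ∧ deriv φ r < alpha0 n m := by
  have hn' : (3 : ℝ) ≤ n := by exact_mod_cast hn
  have hm' : (2 : ℝ) ≤ m := by exact_mod_cast hm
  have hnm' : (8 : ℝ) ≤ n + m := by exact_mod_cast hnm
  have ha : (2 : ℝ) ≤ n - 1 := by linarith
  have hab : (6 : ℝ) ≤ (n - 1) + (m - 1) := by linarith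
  have hquot : (0 : ℝ) < (m - 1) / (n - 1) := div_pos (by linarith) (by linarith)
  have hα : 0 < alpha0 n m := Real.sqrt_pos.2 hquot
  have hb : (m : ℝ) - 1 = (n - 1) * alpha0 n m ^ 2 := by
    rw [alpha0, Real.sq_sqrt hquot.le, mul_div_cancel₀ _ (by linarith)]
  have htop : r₀ = ⊤ := by
    by_contra hne
    have hT : 0 < r₀.toReal := ENNReal.toReal_pos hr₀.ne' hne
    obtain ⟨T', hT', g, q, hg⟩ := (hφ.isProfile (ENNReal.ofReal_toReal hne).le).exists_extension
      hT ha hab hα hb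
    have hle := hmax g _ (hg.isIVPSolTo (hT.trans hT'))
    exact absurd (ENNReal.ofReal_le_iff_le_toReal hne |>.1 hle) (not_le.2 hT')
  refine ⟨htop, fun r hr => ?_⟩
  have h : IsProfile _ _ (r + 1) φ (deriv φ) := hφ.isProfile (htop ▸ le_top)
  have hrT : r ∈ Ioo 0 (r + 1) := ⟨hr, by linarith⟩
  refine ⟨?_, h.sub_mul_slope_pos ha hab hα hb hrT, (h.barrier_pos ha hab hα hb hrT).1,
    h.lt_one_add ha hab hα hb hrT, h.slope_pos ha hab hα hb hrT, h.slope_lt ha hab hα hb hrT⟩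
  rw [(h.hasDerivAt_slope r hrT).deriv]
  exact h.second_deriv_pos ha hab hα hb hrT
end
end

section
/- The maximal solution φ is defined on all of (0,∞), and there is a constant κ = κ(m,n) > 0 such that, as r → ∞: (φ(r) − α₀r)/(κ·r^γ) → 1, (φ(r) − r·φ'(r))/(κ(1−γ)·r^γ) → 1, and φ''(r)/(κ·γ(γ−1)·r^{γ−2}) → 1. -/
open Set Filter
open scoped ENNReal Topology

noncomputable section

/-- A function that starts positive and has positive derivative at each of its zeros stays
positive. -/
theorem pos_of_deriv_pos_of_eq_zero {f f' : ℝ → ℝ} {a b : ℝ} (hab : a ≤ b)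
    (hf : ∀ t ∈ Icc a b, HasDerivAt f (f' t) t) (ha : 0 < f a)
    (h0 : ∀ t ∈ Icc a b, f t = 0 → 0 < f' t) : 0 < f b := by
  rcases hab.eq_or_lt with rfl | hab
  · exact ha
  have hnn : ∀ ⦃x⦄, x ∈ Icc a b → (0 : ℝ) ≤ f x :=
    image_le_of_deriv_right_lt_deriv_boundary' (f := fun _ => (0 : ℝ)) (f' := fun _ => 0)
      continuousOn_const (fun _ _ => hasDerivWithinAt_const _ _ _) ha.le
      (fun t ht => (hf t ht).continuousAt.continuousWithinAt)
      (fun t ht => (hf t (Ico_subset_Icc_self ht)).hasDerivWithinAt)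
      (fun t ht h => h0 t (Ico_subset_Icc_self ht) h.symm)
  have hb : b ∈ Icc a b := right_mem_Icc.2 hab.le
  refine (hnn hb).lt_of_ne' fun hz => ?_
  have hsl := ((hf b hb).hasDerivWithinAt (s := Iio b))
  rw [hasDerivWithinAt_iff_tendsto_slope' (by simp)] at hsl
  have h1 := hsl.eventually (lt_mem_nhds (h0 b hb hz))
  have h2 : ∀ᶠ t in 𝓝[<] b, t ∈ Ioo a b := Ioo_mem_nhdsLT hab
  obtain ⟨t, ht1, ht2⟩ := (h1.and h2).exists
  have h3 := hnn (Ioo_subset_Icc_self ht2)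
  rw [slope_def_field, hz, sub_zero] at ht1
  exact ht1.not_ge (div_nonpos_of_nonneg_of_nonpos h3 (by linarith [ht2.2]))

/-- On the lower barrier curve `5 x⁵ y = 3 x⁴ + 2`, the phase flow points into the region above. -/
theorem barrier_deriv_pos {ν μ x y : ℝ} (hν : 2 ≤ ν) (hνμ : 6 ≤ ν + μ) (hx : 1 < x)
    (h : 5 * x ^ 5 * y - 3 * x ^ 4 - 2 = 0) :
    0 < 25 * x ^ 4 * (y - x) * y + 5 * x ^ 5 * ((1 / x - y) * (ν + μ * y ^ 2))
      - 12 * x ^ 3 * (y - x) := by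
  have hx0 : 0 < x := by linarith
  have hy : y = (3 * x ^ 4 + 2) / (5 * x ^ 5) := by field_simp; linarith
  have hx4 : 1 < x ^ 4 := one_lt_pow₀ hx (by norm_num)
  have hx5 : x ^ 4 < x ^ 5 := pow_lt_pow_right₀ hx (by norm_num)
  have hy0 : 0 < y := by rw [hy]; positivity
  have hy1 : y ≤ 1 := by rw [hy, div_le_one (by positivity)]; linarith
  have hxy : 5 * x ^ 5 * (1 / x - y) = 2 * (x ^ 4 - 1) := by
    field_simp; linarith
  have hlow : 2 + 4 * y ^ 2 ≤ ν + μ * y ^ 2 := by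
    nlinarith [mul_nonneg (sub_nonneg.2 hν) (sub_nonneg.2 (pow_le_one₀ hy0.le hy1 : y ^ 2 ≤ 1)),
      mul_nonneg (sub_nonneg.2 hνμ) (sq_nonneg y)]
  have hmain : 0 < 25 * x ^ 4 * (y - x) * y + 2 * (x ^ 4 - 1) * (2 + 4 * y ^ 2)
      - 12 * x ^ 3 * (y - x) := by
    have e : 25 * x ^ 4 * (y - x) * y + 2 * (x ^ 4 - 1) * (2 + 4 * y ^ 2)
      - 12 * x ^ 3 * (y - x) = (x ^ 2 - 1) * (25 * x ^ 12 + 142 * x ^ 10 - 208 * x ^ 8 - 4 * x ^ 6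
        - 4 * x ^ 4 + 32 * x ^ 2 + 32) / (25 * x ^ 10) := by
      rw [hy]; field_simp; ring
    have hs : 0 < x ^ 2 - 1 := by nlinarith
    rw [e]
    refine div_pos (mul_pos hs ?_) (by positivity)
    obtain ⟨z, hz⟩ : ∃ z, x ^ 2 = 1 + z := ⟨x ^ 2 - 1, by ring⟩
    have hz0 : 0 < z := by linarith
    have e2 : 25 * x ^ 12 + 142 * x ^ 10 - 208 * x ^ 8 - 4 * x ^ 6
        - 4 * x ^ 4 + 32 * x ^ 2 + 32 = 25 * (x ^ 2) ^ 6 + 142 * (x ^ 2) ^ 5 - 208 * (x ^ 2) ^ 4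
        - 4 * (x ^ 2) ^ 3 - 4 * (x ^ 2) ^ 2 + 32 * x ^ 2 + 32 := by ring
    rw [e2, hz]
    ring_nf
    positivity
  have h1 : 2 * (x ^ 4 - 1) * (2 + 4 * y ^ 2) ≤ 2 * (x ^ 4 - 1) * (ν + μ * y ^ 2) :=
    mul_le_mul_of_nonneg_left hlow (by linarith)
  rw [← mul_assoc (5 * x ^ 5), hxy]
  linarith

/-- A nondecreasing function that tends to zero at `-∞` is nonnegative. -/
theorem nonneg_of_tendsto_atBot {f f' : ℝ → ℝ} {b : ℝ}
    (hf : ∀ t ≤ b, HasDerivAt f (f' t) t) (hf' : ∀ t ≤ b, 0 ≤ f' t)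
    (h : Tendsto f atBot (𝓝 0)) : 0 ≤ f b := by
  have hmono : MonotoneOn f (Iic b) :=
    monotoneOn_of_hasDerivWithinAt_nonneg (convex_Iic b)
      (fun t ht => (hf t ht).continuousAt.continuousWithinAt)
      (fun t ht => (hf t (interior_subset (s := Iic b) ht)).hasDerivWithinAt)
      (fun t ht => hf' t (interior_subset (s := Iic b) ht))
  refine le_of_tendsto h ?_
  filter_upwards [eventually_le_atBot b] with t ht
  exact hmono ht self_mem_Iic ht

/-- `(x, y)` solves, on `(-∞, T)`, the planar autonomous system obtained from the profile equation
by `x = φ / (α r)`, `y = φ' / α`, `t = log r`, with `x ∼ β e^{-t}` and `y → 0` as `t → -∞`. -/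
structure IsPhaseSol (ν μ β T : ℝ) (x y : ℝ → ℝ) : Prop where
  deriv_fst : ∀ t < T, HasDerivAt x (y t - x t) t
  deriv_snd : ∀ t < T, HasDerivAt y ((1 / x t - y t) * (ν + μ * y t ^ 2)) t
  tendsto_fst : Tendsto (fun t => x t * Real.exp t) atBot (𝓝 β)
  tendsto_snd : Tendsto y atBot (𝓝 0)

/-- The region `(3 + 2 x⁻⁴) / (5 x) < y < 1 / x`, `x > 1` of the phase plane. -/
def InRegion (x y : ℝ) : Prop := 1 < x ∧ 0 < 5 * x ^ 5 * y - 3 * x ^ 4 - 2 ∧ 0 < 1 - x * y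

theorem InRegion.snd_pos {x y : ℝ} (h : InRegion x y) : 0 < y := by
  obtain ⟨h1, h2, -⟩ := h
  have hx0 : 0 < x := by linarith
  have : 0 < 5 * x ^ 5 * y := by have := pow_pos hx0 4; linarith
  exact pos_of_mul_pos_right this (by positivity)

theorem InRegion.snd_lt_one {x y : ℝ} (h : InRegion x y) : y < 1 := by
  have := h.snd_pos
  obtain ⟨h1, -, h3⟩ := h
  nlinarith

/-- The region lies above a line of slope `-13/5` through the equilibrium `(1, 1)`. -/
theorem InRegion.snd_lower {x y : ℝ} (h : InRegion x y) : 1 - 13 / 5 * (x - 1) < y := by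
  obtain ⟨h1, h2, -⟩ := h
  have hx0 : 0 < x := by linarith
  have h5 : 0 < x ^ 5 := by positivity
  have key : 0 ≤ (x - 1) ^ 2 * (13 * x ^ 4 + 8 * x ^ 3 + 6 * x ^ 2 + 4 * x + 2) := by positivity
  by_contra! hy
  have := mul_le_mul_of_nonneg_left hy h5.le
  nlinarith

namespace IsPhaseSol

variable {ν μ β T : ℝ} {x y : ℝ → ℝ}

theorem hasDerivAt_lower (h : IsPhaseSol ν μ β T x y) {t : ℝ} (ht : t < T) :
    HasDerivAt (fun s => 5 * x s ^ 5 * y s - 3 * x s ^ 4 - 2)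
      (25 * x t ^ 4 * (y t - x t) * y t + 5 * x t ^ 5 * ((1 / x t - y t) * (ν + μ * y t ^ 2))
        - 12 * x t ^ 3 * (y t - x t)) t := by
  have hx := h.deriv_fst t ht
  have hy := h.deriv_snd t ht
  refine HasDerivAt.congr_deriv
    (((((hx.pow 5).const_mul 5).mul hy).sub ((hx.pow 4).const_mul 3)).sub_const 2) ?_
  push_cast [Pi.pow_apply]
  ring

theorem hasDerivAt_upper (h : IsPhaseSol ν μ β T x y) {t : ℝ} (ht : t < T) :
    HasDerivAt (fun s => 1 - x s * y s)
      (-((y t - x t) * y t + x t * ((1 / x t - y t) * (ν + μ * y t ^ 2)))) t :=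
  ((h.deriv_fst t ht).mul (h.deriv_snd t ht)).const_sub 1

theorem lower_pos_of_lower_pos (h : IsPhaseSol ν μ β T x y) (hν : 2 ≤ ν) (hνμ : 6 ≤ ν + μ)
    {a b : ℝ} (hab : a ≤ b) (hb : b < T) (hx : ∀ t ∈ Icc a b, 1 < x t)
    (ha : 0 < 5 * x a ^ 5 * y a - 3 * x a ^ 4 - 2) :
    0 < 5 * x b ^ 5 * y b - 3 * x b ^ 4 - 2 :=
  pos_of_deriv_pos_of_eq_zero (f := fun s => 5 * x s ^ 5 * y s - 3 * x s ^ 4 - 2) hab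
    (fun _ ht => h.hasDerivAt_lower (ht.2.trans_lt hb)) ha
    fun t ht h0 => barrier_deriv_pos hν hνμ (hx t ht) h0

theorem upper_pos_of_upper_pos (h : IsPhaseSol ν μ β T x y)
    {a b : ℝ} (hab : a ≤ b) (hb : b < T) (hx : ∀ t ∈ Icc a b, 1 < x t)
    (ha : 0 < 1 - x a * y a) : 0 < 1 - x b * y b := by
  refine pos_of_deriv_pos_of_eq_zero (f := fun s => 1 - x s * y s) hab
    (fun _ ht => h.hasDerivAt_upper (ht.2.trans_lt hb)) ha fun t ht h0 => ?_
  have hx1 := hx t ht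
  have hy : y t = 1 / x t := by field_simp; linarith
  have hy0 : 0 < y t := by rw [hy]; positivity
  have hy1 : y t < x t := by nlinarith
  rw [← hy]
  nlinarith

/-- The phase trajectory starts out in the region: otherwise `y` would be too small, or negative. -/
theorem eventually_inRegion (h : IsPhaseSol ν μ β T x y) (hν : 2 ≤ ν) (hμ : 0 ≤ μ)
    (hνμ : 6 ≤ ν + μ) (hβ : 0 < β) : ∀ᶠ t in atBot, InRegion (x t) (y t) := by
  have hev : ∀ᶠ t in atBot, t < T ∧ 19 / 20 * β < x t * Real.exp t ∧
      x t * Real.exp t < 21 / 20 * β ∧ 2 < x t := by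
    filter_upwards [eventually_lt_atBot T,
      h.tendsto_fst.eventually (lt_mem_nhds (show 19 / 20 * β < β by linarith)),
      h.tendsto_fst.eventually (gt_mem_nhds (show β < 21 / 20 * β by linarith)),
      Real.tendsto_exp_atBot.eventually (gt_mem_nhds (show 0 < β / 4 by linarith))]
      with t h1 h2 h3 h4
    refine ⟨h1, h2, h3, ?_⟩
    by_contra! h5
    have := mul_le_mul_of_nonneg_right h5 (Real.exp_pos t).le
    linarith
  obtain ⟨t₀, ht₀⟩ := eventually_atBot.1 hev
  filter_upwards [eventually_le_atBot t₀] with t₁ ht₁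
  have hT : t₁ < T := (ht₀ t₁ ht₁).1
  have hx1 : ∀ t ≤ t₁, 1 < x t := fun t ht => by linarith [(ht₀ t (ht.trans ht₁)).2.2.2]
  refine ⟨hx1 t₁ le_rfl, ?_, ?_⟩
  · by_contra hneg
    have hD : ∀ t ≤ t₁, 5 * x t ^ 5 * y t - 3 * x t ^ 4 - 2 ≤ 0 := fun t ht => by
      by_contra! hpos
      exact hneg (h.lower_pos_of_lower_pos hν hνμ ht hT (fun s hs => hx1 s hs.2) hpos)
    have hbd : ∀ t ≤ t₁, y t ≤ 5 / 8 * (1 / x t) := fun t ht => by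
      have hx2 := (ht₀ t (ht.trans ht₁)).2.2.2
      have h4 : (2 : ℝ) ^ 4 ≤ x t ^ 4 := by gcongr
      have h0 := hD t ht
      have h5 : x t ^ 4 * (x t * y t - 5 / 8) ≤ 0 := by nlinarith
      have h6 : x t * y t - 5 / 8 ≤ 0 := by
        by_contra! hc
        exact absurd h5 (not_le.2 (by positivity))
      rw [mul_one_div, le_div_iff₀ (by linarith)]
      linarith
    have hexp : ∀ t ≤ t₁, 20 / 21 * (Real.exp t / β) ≤ 1 / x t := fun t ht => by
      have h3 := (ht₀ t (ht.trans ht₁)).2.2.1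
      have hx0 : 0 < x t := by linarith [hx1 t ht]
      rw [← mul_div_assoc, div_le_div_iff₀ hβ hx0]
      linarith
    have hlim : Tendsto (fun t => y t - 5 / 7 * (Real.exp t / β)) atBot (𝓝 0) := by
      simpa using h.tendsto_snd.sub ((Real.tendsto_exp_atBot.div_const β).const_mul (5 / 7))
    have hge := nonneg_of_tendsto_atBot (f := fun t => y t - 5 / 7 * (Real.exp t / β)) (b := t₁)
      (fun t ht =>
      (h.deriv_snd t (ht.trans_lt hT)).sub
        (((Real.hasDerivAt_exp t).div_const β).const_mul (5 / 7))) (fun t ht => by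
        have h1 := hbd t ht
        have h2 := hexp t ht
        have hx0 : 0 < 1 / x t := one_div_pos.2 (by linarith [hx1 t ht])
        have h3 : 2 ≤ ν + μ * y t ^ 2 := by nlinarith [sq_nonneg (y t)]
        have h4 : (1 / x t - y t) * 2 ≤ (1 / x t - y t) * (ν + μ * y t ^ 2) :=
          mul_le_mul_of_nonneg_left h3 (by linarith)
        linarith) hlim
    have h2 := (ht₀ t₁ ht₁).2.1
    have hx0 : 0 < x t₁ := by linarith [hx1 t₁ le_rfl]
    have h7 : 19 / 20 * (1 / x t₁) ≤ Real.exp t₁ / β := by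
      rw [mul_one_div, div_le_div_iff₀ hx0 hβ]
      linarith
    have h8 := hbd t₁ le_rfl
    have : 0 < 1 / x t₁ := by positivity
    linarith
  · by_contra hneg
    have hE : ∀ t ≤ t₁, 1 - x t * y t ≤ 0 := fun t ht => by
      by_contra! hpos
      exact hneg (h.upper_pos_of_upper_pos ht hT (fun s hs => hx1 s hs.2) hpos)
    have hge := nonneg_of_tendsto_atBot (f := fun t => -y t) (b := t₁)
      (fun t ht => (h.deriv_snd t (ht.trans_lt hT)).neg)
      (fun t ht => by
        have hx0 : 0 < x t := by linarith [hx1 t ht]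
        have h1 : 1 / x t ≤ y t := by rw [div_le_iff₀ hx0]; linarith [hE t ht]
        have h2 : 0 ≤ ν + μ * y t ^ 2 := by positivity
        nlinarith) (by simpa using h.tendsto_snd.neg : Tendsto (fun t => -y t) atBot (𝓝 0))
    have := hE t₁ le_rfl
    have := hx1 t₁ le_rfl
    nlinarith

/-- The phase trajectory stays in the region, because `x - 1` decays at most exponentially and
neither barrier can be crossed while `x > 1`. -/
theorem inRegion (h : IsPhaseSol ν μ β T x y) (hν : 2 ≤ ν) (hμ : 0 ≤ μ)
    (hνμ : 6 ≤ ν + μ) (hβ : 0 < β) {t : ℝ} (ht : t < T) : InRegion (x t) (y t) := by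
  obtain ⟨t₀, ht₀⟩ := eventually_atBot.1 (h.eventually_inRegion hν hμ hνμ hβ)
  by_contra hbad
  have ht₀t : t₀ ≤ t := by
    by_contra! hlt
    exact hbad (ht₀ t hlt.le)
  set S : Set ℝ := {s | s ∈ Icc t₀ t ∧ ¬ InRegion (x s) (y s)} with hS
  have hSne : S.Nonempty := ⟨t, ⟨ht₀t, le_rfl⟩, hbad⟩
  have hSb : BddBelow S := ⟨t₀, fun s hs => hs.1.1⟩
  set τ := sInf S with hτ
  have hτ0 : t₀ ≤ τ := le_csInf hSne fun s hs => hs.1.1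
  have hτt : τ ≤ t := csInf_le hSb ⟨⟨ht₀t, le_rfl⟩, hbad⟩
  have hτT : τ < T := hτt.trans_lt ht
  have hbefore : ∀ s < τ, InRegion (x s) (y s) := fun s hs => by
    by_contra hc
    rcases le_total s t₀ with h1 | h1
    · exact hc (ht₀ s h1)
    · exact absurd (csInf_le hSb (show s ∈ S from ⟨⟨h1, hs.le.trans hτt⟩, hc⟩)) (not_le.2 hs)
  have hderiv : ∀ s ≤ τ, HasDerivAt (fun s => (x s - 1) * Real.exp (18 / 5 * s))
      ((y s - x s) * Real.exp (18 / 5 * s) +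
        (x s - 1) * (Real.exp (18 / 5 * s) * (18 / 5 * 1))) s := fun s hs =>
    ((h.deriv_fst s (hs.trans_lt hτT)).sub_const 1).mul
      (((hasDerivAt_id s).const_mul (18 / 5)).exp)
  have hmono : MonotoneOn (fun s => (x s - 1) * Real.exp (18 / 5 * s)) (Icc t₀ τ) := by
    refine monotoneOn_of_hasDerivWithinAt_nonneg (convex_Icc _ _)
      (fun s hs => (hderiv s hs.2).continuousAt.continuousWithinAt)
      (fun s hs => (hderiv s (interior_subset hs).2).hasDerivWithinAt) fun s hs => ?_
    rw [interior_Icc] at hs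
    have h1 := (hbefore s hs.2).snd_lower
    have h2 := Real.exp_pos (18 / 5 * s)
    have : (y s - x s) * Real.exp (18 / 5 * s) +
        (x s - 1) * (Real.exp (18 / 5 * s) * (18 / 5 * 1)) =
        (y s - x s + 18 / 5 * (x s - 1)) * Real.exp (18 / 5 * s) := by ring
    rw [this]
    exact mul_nonneg (by linarith) h2.le
  have hxτ : 1 < x τ := by
    have h1 := hmono (left_mem_Icc.2 hτ0) (right_mem_Icc.2 hτ0) hτ0
    have h2 : 0 < (x t₀ - 1) * Real.exp (18 / 5 * t₀) :=
      mul_pos (by linarith [(ht₀ t₀ le_rfl).1]) (Real.exp_pos _)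
    have h3 := pos_of_mul_pos_left (h2.trans_le h1) (Real.exp_pos _).le
    linarith
  have hx1 : ∀ s ∈ Icc t₀ τ, 1 < x s := fun s hs => by
    rcases hs.2.eq_or_lt with rfl | h1
    · exact hxτ
    · exact (hbefore s h1).1
  have hr : InRegion (x τ) (y τ) :=
    ⟨hxτ, h.lower_pos_of_lower_pos hν hνμ hτ0 hτT hx1 (ht₀ t₀ le_rfl).2.1,
      h.upper_pos_of_upper_pos hτ0 hτT hx1 (ht₀ t₀ le_rfl).2.2⟩
  have hev : ∀ᶠ s in 𝓝 τ, InRegion (x s) (y s) :=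
    ((h.deriv_fst τ hτT).continuousAt.eventually (lt_mem_nhds hr.1)).and
      (((h.hasDerivAt_lower hτT).continuousAt.eventually (lt_mem_nhds hr.2.1)).and
        ((h.hasDerivAt_upper hτT).continuousAt.eventually (lt_mem_nhds hr.2.2)))
  obtain ⟨δ, hδ, hball⟩ := Metric.eventually_nhds_iff.1 hev
  obtain ⟨s, hs, hsτ⟩ := exists_lt_of_csInf_lt hSne (show sInf S < τ + δ by linarith)
  refine hs.2 (hball ?_)
  have := csInf_le hSb hs
  rw [Real.dist_eq, abs_lt]
  constructor <;> linarith

theorem antitoneOn_fst (h : IsPhaseSol ν μ β T x y) (hν : 2 ≤ ν) (hμ : 0 ≤ μ)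
    (hνμ : 6 ≤ ν + μ) (hβ : 0 < β) : AntitoneOn x (Iio T) :=
  antitoneOn_of_hasDerivWithinAt_nonpos (convex_Iio T)
    (fun t ht => (h.deriv_fst t ht).continuousAt.continuousWithinAt)
    (fun t ht => (h.deriv_fst t (interior_subset (s := Iio T) ht)).hasDerivWithinAt) fun t ht => by
      have hr := h.inRegion hν hμ hνμ hβ (interior_subset (s := Iio T) ht)
      linarith [hr.1, hr.snd_lt_one]

end IsPhaseSol

/-- Two differentiable functions with matching values and derivatives glue to a differentiable
function. -/
theorem hasDerivAt_ite_le {f g : ℝ → ℝ} {a c t : ℝ} (hfg : f c = g c)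
    (hf : t ≤ c → HasDerivAt f a t) (hg : c ≤ t → HasDerivAt g a t) :
    HasDerivAt (fun s => if s ≤ c then f s else g s) a t := by
  rcases lt_trichotomy t c with h | rfl | h
  · refine (hf h.le).congr_of_eventuallyEq ?_
    filter_upwards [gt_mem_nhds h] with s hs
    exact if_pos hs.le
  · have h1 : HasDerivWithinAt (fun s => if s ≤ t then f s else g s) a (Iic t) t :=
      (hf le_rfl).hasDerivWithinAt.congr (fun s hs => if_pos hs) (if_pos le_rfl)
    have h2 : HasDerivWithinAt (fun s => if s ≤ t then f s else g s) a (Ici t) t := by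
      refine (hg le_rfl).hasDerivWithinAt.congr (fun s hs => ?_) (by simp [hfg])
      rcases (show t ≤ s from hs).eq_or_lt with rfl | hlt
      · simp [hfg]
      · exact if_neg hlt.not_ge
    have h3 := h1.union h2
    rwa [Iic_union_Ici, hasDerivWithinAt_univ] at h3
  · refine (hg h.le).congr_of_eventuallyEq ?_
    filter_upwards [lt_mem_nhds h] with s hs
    exact if_neg hs.not_ge

/-- A phase trajectory on a half-line bounded above extends beyond the endpoint. -/
theorem IsPhaseSol.exists_extension {ν μ β T : ℝ} {x y : ℝ → ℝ} (h : IsPhaseSol ν μ β T x y)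
    (hν : 2 ≤ ν) (hμ : 0 ≤ μ) (hνμ : 6 ≤ ν + μ) (hβ : 0 < β) :
    ∃ T' > T, ∃ X Y : ℝ → ℝ, IsPhaseSol ν μ β T' X Y := by
  set V : ℝ × ℝ → ℝ × ℝ := fun z => (z.2 - z.1, (1 / z.1 - z.2) * (ν + μ * z.2 ^ 2)) with hV
  have hK : IsCompact (Icc 1 (x (T - 1)) ×ˢ Icc (0 : ℝ) 1) := isCompact_Icc.prod isCompact_Icc
  have hev : ∀ᶠ t in 𝓝[<] T, (x t, y t) ∈ Icc 1 (x (T - 1)) ×ˢ Icc (0 : ℝ) 1 := by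
    filter_upwards [Ioo_mem_nhdsLT (show T - 1 < T by linarith)] with t ht
    have hr := h.inRegion hν hμ hνμ hβ ht.2
    exact ⟨⟨hr.1.le, h.antitoneOn_fst hν hμ hνμ hβ (show T - 1 < T by linarith) ht.2 ht.1.le⟩,
      hr.snd_pos.le, hr.snd_lt_one.le⟩
  obtain ⟨z₀, hz₀, hcl⟩ := hK.exists_mapClusterPt_of_frequently hev.frequently
  have hz₀1 : z₀.1 ≠ 0 := by
    have : (1 : ℝ) ≤ z₀.1 := hz₀.1.1
    linarith
  have hVd : ContDiffAt ℝ 1 V z₀ := by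
    refine (contDiffAt_snd.sub contDiffAt_fst).prodMk
      (((contDiffAt_const.div contDiffAt_fst hz₀1).sub contDiffAt_snd).mul
        (contDiffAt_const.add (contDiffAt_const.mul (contDiffAt_snd.pow 2))))
  obtain ⟨ρ, hρ, ε, hε, H⟩ :=
    hVd.exists_forall_mem_closedBall_exists_eq_forall_mem_Ioo_hasDerivAt 0
  obtain ⟨t₁, hball, ht₁⟩ := ((mapClusterPt_iff_frequently.1 hcl _
    (Metric.closedBall_mem_nhds z₀ hρ)).and_eventually
      (Ioo_mem_nhdsLT (show T - ε < T by linarith))).exists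
  obtain ⟨Z, hZ0, hZ⟩ := H _ hball
  have hZd : ∀ t, t₁ ≤ t → t < t₁ + ε →
      HasDerivAt (fun s => Z (s - t₁)) (V (Z (t - t₁))) t := fun t h1 h2 =>
    (hZ (t - t₁) ⟨by linarith, by linarith⟩).comp_sub_const t t₁
  have hx₁ : x t₁ = (Z (t₁ - t₁)).1 := by rw [sub_self, hZ0]
  have hy₁ : y t₁ = (Z (t₁ - t₁)).2 := by rw [sub_self, hZ0]
  have hXev : (fun t => if t ≤ t₁ then x t else (Z (t - t₁)).1) =ᶠ[atBot] x := by
    filter_upwards [eventually_le_atBot t₁] with t ht using if_pos ht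
  have hYev : (fun t => if t ≤ t₁ then y t else (Z (t - t₁)).2) =ᶠ[atBot] y := by
    filter_upwards [eventually_le_atBot t₁] with t ht using if_pos ht
  refine ⟨t₁ + ε, by linarith [ht₁.1], fun t => if t ≤ t₁ then x t else (Z (t - t₁)).1,
    fun t => if t ≤ t₁ then y t else (Z (t - t₁)).2, ⟨fun t ht => ?_, fun t ht => ?_, ?_, ?_⟩⟩
  · refine hasDerivAt_ite_le hx₁ (fun hle => ?_) (fun hle => ?_)
    · simpa only [if_pos hle] using h.deriv_fst t (hle.trans_lt ht₁.2)
    · refine ((hasFDerivAt_fst.comp_hasDerivAt t (hZd t hle ht))).congr_deriv ?_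
      rcases hle.eq_or_lt with rfl | hlt
      · simp [hV, hx₁, hy₁]
      · simp [hV, hlt.not_ge]
  · refine hasDerivAt_ite_le hy₁ (fun hle => ?_) (fun hle => ?_)
    · simpa only [if_pos hle] using h.deriv_snd t (hle.trans_lt ht₁.2)
    · refine ((hasFDerivAt_snd.comp_hasDerivAt t (hZd t hle ht))).congr_deriv ?_
      rcases hle.eq_or_lt with rfl | hlt
      · simp [hV, hx₁, hy₁]
      · simp [hV, hlt.not_ge]
  · exact h.tendsto_fst.congr' (hXev.symm.mul EventuallyEq.rfl)
  · exact h.tendsto_snd.congr' hYev.symm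

/-- A function whose derivative is `O(e^{-t})` converges at infinity. -/
theorem exists_tendsto_of_abs_deriv_le_exp_neg {f f' : ℝ → ℝ} {C a : ℝ}
    (hf : ∀ t ∈ Ioi a, HasDerivAt f (f' t) t) (hC : ∀ t ∈ Ioi a, |f' t| ≤ C * Real.exp (-t)) :
    ∃ l, Tendsto f atTop (𝓝 l) := by
  refine ⟨_, MeasureTheory.tendsto_limUnder_of_hasDerivAt_of_integrableOn_Ioi (f' := deriv f)
    (fun t ht => (hf t ht).differentiableAt.hasDerivAt) ?_⟩
  refine ((integrableOn_exp_neg_Ioi a).const_mul C).mono' (aestronglyMeasurable_deriv f _) ?_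
  refine (MeasureTheory.ae_restrict_iff' measurableSet_Ioi).2
    (MeasureTheory.ae_of_all _ fun t ht => ?_)
  rw [(hf t ht).deriv]
  exact hC t ht

/-- A damped linear equation with forcing `O(e^{-t})` has only solutions tending to zero. -/
theorem tendsto_zero_of_deriv_eq_neg_mul_add {g h : ℝ → ℝ} {C η a : ℝ} (hη : 1 ≤ η) (ha : 0 ≤ a)
    (hC0 : 0 ≤ C) (hg : ∀ t ≥ a, HasDerivAt g (-η * g t + h t) t)
    (hC : ∀ t ≥ a, |h t| ≤ C * Real.exp (-t)) : Tendsto g atTop (𝓝 0) := by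
  have hη' : 0 < η - 1 / 2 := by linarith
  have hG : ∀ t ≥ a, HasDerivAt (fun s => g s * Real.exp (η * s)) (h t * Real.exp (η * t)) t :=
    fun t ht => ((hg t ht).mul ((hasDerivAt_id t).const_mul η).exp).congr_deriv (by simp; ring)
  set c := C / (η - 1 / 2) with hc
  have hc0 : 0 ≤ c := by positivity
  have hcη : c * (η - 1 / 2) = C := div_mul_cancel₀ _ hη'.ne'
  set K := |g a * Real.exp (η * a)| with hK
  have hB : ∀ t, HasDerivAt (fun s => K + c * Real.exp ((η - 1 / 2) * s))
      (C * Real.exp ((η - 1 / 2) * t)) t := fun t =>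
    ((((hasDerivAt_id t).const_mul (η - 1 / 2)).exp.const_mul c).const_add K).congr_deriv (by
      rw [← hcη]; simp; ring)
  have hbound : ∀ t ≥ a, |g t * Real.exp (η * t)| ≤ K + c * Real.exp ((η - 1 / 2) * t) := by
    intro t ht
    refine image_norm_le_of_norm_deriv_right_le_deriv_boundary'
      (f := fun s => g s * Real.exp (η * s)) (a := a) (b := t)
      (fun s hs => (hG s hs.1).continuousAt.continuousWithinAt)
      (fun s hs => (hG s hs.1).hasDerivWithinAt) ?_
      (fun s _ => (hB s).continuousAt.continuousWithinAt)
      (fun s _ => (hB s).hasDerivWithinAt) ?_ (right_mem_Icc.2 ht)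
    · rw [Real.norm_eq_abs, ← hK]
      have : 0 ≤ c * Real.exp ((η - 1 / 2) * a) := by positivity
      linarith
    · intro s hs
      rw [Real.norm_eq_abs, abs_mul, Real.abs_exp]
      calc |h s| * Real.exp (η * s) ≤ C * Real.exp (-s) * Real.exp (η * s) := by
            gcongr; exact hC s hs.1
        _ = C * Real.exp ((η - 1) * s) := by rw [mul_assoc, ← Real.exp_add]; ring_nf
        _ ≤ C * Real.exp ((η - 1 / 2) * s) := by
            have : 0 ≤ s := ha.trans hs.1
            gcongr
            norm_num
  have hlim : Tendsto (fun t => K * Real.exp (-(η * t)) + c * Real.exp (-(1 / 2 * t))) atTop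
      (𝓝 0) := by
    have h1 := (Real.tendsto_exp_neg_atTop_nhds_zero.comp
      (tendsto_id.const_mul_atTop (show 0 < η by linarith))).const_mul K
    have h2 := (Real.tendsto_exp_neg_atTop_nhds_zero.comp
      (tendsto_id.const_mul_atTop (show (0 : ℝ) < 1 / 2 by norm_num))).const_mul c
    simpa using h1.add h2
  refine squeeze_zero_norm' ?_ hlim
  filter_upwards [eventually_ge_atTop a] with t ht
  have h1 := mul_le_mul_of_nonneg_right (hbound t ht) (Real.exp_pos (-(η * t))).le
  have h2 : Real.exp (η * t) * Real.exp (-(η * t)) = 1 := by rw [← Real.exp_add]; simp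
  have h3 : Real.exp ((η - 1 / 2) * t) * Real.exp (-(η * t)) = Real.exp (-(1 / 2 * t)) := by
    rw [← Real.exp_add]; ring_nf
  rwa [abs_mul, Real.abs_exp, mul_assoc, h2, mul_one, add_mul, mul_assoc, h3] at h1

/-- The remainder of the linearization of the phase system at `(1, 1)` is quadratic. -/
theorem InRegion.abs_remainder_le {ν μ x y : ℝ} (h : InRegion x y) (hν : 0 ≤ ν) (hμ : 0 ≤ μ) :
    |(1 / x - y) * (ν + μ * y ^ 2) + (ν + μ) * ((x - 1) + (y - 1))|
      ≤ (ν + 15 * μ) * (x - 1) ^ 2 := by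
  have hy0 := h.snd_pos
  have hy1 := h.snd_lt_one
  have hy2 := h.snd_lower
  have hx := h.1
  have hx0 : 0 < x := by linarith
  have h1 : 0 < 1 / x - y := by
    rw [sub_pos, lt_div_iff₀ hx0]; linarith [h.2.2]
  have h2 : 1 / x < 1 := by rw [div_lt_one hx0]; exact hx
  have heq : (1 / x - y) * (ν + μ * y ^ 2) + (ν + μ) * ((x - 1) + (y - 1)) =
      (ν + μ) * ((x - 1) ^ 2 * (1 / x)) - μ * ((1 / x - y) * (1 - y ^ 2)) := by
    field_simp; ring
  have h3 : 0 ≤ (x - 1) ^ 2 * (1 / x) := by positivity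
  have h4 : (x - 1) ^ 2 * (1 / x) ≤ (x - 1) ^ 2 := mul_le_of_le_one_right (sq_nonneg _) h2.le
  have h5 : 0 ≤ (1 / x - y) * (1 - y ^ 2) := mul_nonneg h1.le (by nlinarith)
  have h6 : (1 / x - y) * (1 - y ^ 2) ≤ 14 * (x - 1) ^ 2 := by
    have h7 : 1 / x - y ≤ 13 / 5 * (x - 1) := by linarith
    have h8 : 1 - y ^ 2 ≤ 26 / 5 * (x - 1) := by nlinarith
    have := mul_le_mul h7 h8 (by nlinarith) (by linarith)
    nlinarith [sq_nonneg (x - 1)]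
  have h9 := mul_le_mul_of_nonneg_left h4 (add_nonneg hν hμ)
  have h10 := mul_le_mul_of_nonneg_left h6 hμ
  have h11 := mul_nonneg (add_nonneg hν hμ) h3
  have h12 := mul_nonneg hμ h5
  rw [heq, abs_le]
  constructor <;> nlinarith [mul_nonneg hν (sq_nonneg (x - 1)), mul_nonneg hμ (sq_nonneg (x - 1))]

/-- Convergence rate of the phase trajectory to the equilibrium `(1, 1)`: the trajectory is tangent
to the slow eigendirection, with eigenvalue `γ - 1`. -/
theorem exists_phase_asymptotics {ν μ γ δ : ℝ} {x y : ℝ → ℝ} (hν : 0 ≤ ν) (hμ : 0 ≤ μ)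
    (hsum : γ + δ = 1 - (ν + μ)) (hprod : γ * δ = ν + μ) (hδ : δ ≤ -3) (hη : 1 ≤ γ - δ)
    (hx : ∀ t, HasDerivAt x (y t - x t) t)
    (hy : ∀ t, HasDerivAt y ((1 / x t - y t) * (ν + μ * y t ^ 2)) t)
    (hr : ∀ t, InRegion (x t) (y t)) :
    ∃ κ : ℝ, 0 < κ ∧
      Tendsto (fun t => (x t - 1) * Real.exp ((1 - γ) * t)) atTop (𝓝 κ) ∧
      Tendsto (fun t => (y t - 1) * Real.exp ((1 - γ) * t)) atTop (𝓝 (γ * κ)) ∧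
      Tendsto (fun t => (1 / x t - y t) * (ν + μ * y t ^ 2) * Real.exp ((1 - γ) * t)) atTop
        (𝓝 (γ * (γ - 1) * κ)) := by
  set R : ℝ → ℝ := fun t =>
    (1 / x t - y t) * (ν + μ * y t ^ 2) + (ν + μ) * ((x t - 1) + (y t - 1)) with hRdef
  set E : ℝ → ℝ := fun t => Real.exp ((1 - γ) * t) with hEdef
  have hE0 : ∀ t, 0 < E t := fun t => Real.exp_pos _
  have hE : ∀ t, HasDerivAt E ((1 - γ) * E t) t := fun t =>
    ((hasDerivAt_id t).const_mul (1 - γ)).exp.congr_deriv (by simp [hEdef]; ring)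
  set K := ν + 15 * μ with hK
  have hK0 : 0 ≤ K := by positivity
  have hR : ∀ t, |R t| ≤ K * (x t - 1) ^ 2 := fun t => (hr t).abs_remainder_le hν hμ
  have hp : ∀ t, 0 < x t - 1 := fun t => sub_pos.2 (hr t).1
  set P := x 0 - 1 with hP
  have hP0 : 0 < P := hp 0
  have hdecay : ∀ t ≥ 0, x t - 1 ≤ P * Real.exp (-t) := by
    have hd : ∀ t, HasDerivAt (fun s => (x s - 1) * Real.exp s) ((y t - 1) * Real.exp t) t :=
      fun t => (((hx t).sub_const 1).mul (Real.hasDerivAt_exp t)).congr_deriv (by ring)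
    have hanti : Antitone (fun s => (x s - 1) * Real.exp s) :=
      antitone_of_hasDerivAt_nonpos hd fun t =>
        mul_nonpos_of_nonpos_of_nonneg (by linarith [(hr t).snd_lt_one]) (Real.exp_pos t).le
    intro t ht
    have h1 := mul_le_mul_of_nonneg_right (hanti ht) (Real.exp_pos (-t)).le
    simpa [mul_assoc, ← Real.exp_add] using h1
  have hA : ∀ t, HasDerivAt (fun s => (y s - 1 - δ * (x s - 1)) * E s) (R t * E t) t := fun t =>
    ((((hy t).sub_const 1).sub (((hx t).sub_const 1).const_mul δ)).mul (hE t)).congr_deriv (by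
      simp only [hRdef, Pi.sub_apply]
      linear_combination E t * ((x t - 1) * hprod - (y t - 1) * hsum))
  have hB : ∀ t, HasDerivAt (fun s => (y s - 1 - γ * (x s - 1)) * E s)
      (-(γ - δ) * ((y t - 1 - γ * (x t - 1)) * E t) + R t * E t) t := fun t =>
    ((((hy t).sub_const 1).sub (((hx t).sub_const 1).const_mul γ)).mul (hE t)).congr_deriv (by
      simp only [hRdef, Pi.sub_apply]
      linear_combination E t * ((x t - 1) * hprod - (y t - 1) * hsum))
  have hAp : ∀ t, 2 / 5 * (x t - 1) ≤ y t - 1 - δ * (x t - 1) := fun t => by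
    nlinarith [(hr t).snd_lower, hp t]
  have hApos : ∀ t, 0 < y t - 1 - δ * (x t - 1) := fun t => by linarith [hAp t, hp t]
  have hRA : ∀ t ≥ 0, |R t| ≤ 5 / 2 * K * P * Real.exp (-t) * (y t - 1 - δ * (x t - 1)) := by
    intro t ht
    calc |R t| ≤ K * (x t - 1) ^ 2 := hR t
      _ = K * (x t - 1) * (x t - 1) := by ring
      _ ≤ K * (P * Real.exp (-t)) * (5 / 2 * (y t - 1 - δ * (x t - 1))) := by
          have := hp t
          gcongr
          · exact hdecay t ht
          · linarith [hAp t]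
      _ = _ := by ring
  obtain ⟨l, hl⟩ : ∃ l, Tendsto (fun t => Real.log ((y t - 1 - δ * (x t - 1)) * E t)) atTop
      (𝓝 l) := by
    refine exists_tendsto_of_abs_deriv_le_exp_neg (a := 0) (C := 5 / 2 * K * P)
      (fun t _ => (hA t).log (mul_pos (hApos t) (hE0 t)).ne') fun t ht => ?_
    rw [mul_div_mul_right _ _ (hE0 t).ne', abs_div, abs_of_pos (hApos t), div_le_iff₀ (hApos t)]
    exact hRA t (le_of_lt ht)
  have hAlim : Tendsto (fun t => (y t - 1 - δ * (x t - 1)) * E t) atTop (𝓝 (Real.exp l)) :=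
    ((Real.continuous_exp.tendsto l).comp hl).congr fun t =>
      Real.exp_log (mul_pos (hApos t) (hE0 t))
  obtain ⟨a, ha⟩ := eventually_atTop.1
    ((hAlim.eventually (gt_mem_nhds (lt_add_one _))).and (eventually_ge_atTop 0))
  have ha0 : 0 ≤ a := (ha a le_rfl).2
  set C := 5 / 2 * K * P * (Real.exp l + 1) with hC
  have hRE : ∀ t ≥ a, |R t * E t| ≤ C * Real.exp (-t) := by
    intro t ht
    rw [abs_mul, abs_of_pos (hE0 t)]
    calc |R t| * E t ≤ 5 / 2 * K * P * Real.exp (-t) * (y t - 1 - δ * (x t - 1)) * E t := by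
          gcongr
          exact hRA t (ha t ht).2
      _ = 5 / 2 * K * P * Real.exp (-t) * ((y t - 1 - δ * (x t - 1)) * E t) := by ring
      _ ≤ 5 / 2 * K * P * Real.exp (-t) * (Real.exp l + 1) := by
          gcongr
          exact (ha t ht).1.le
      _ = C * Real.exp (-t) := by ring
  have hBlim : Tendsto (fun t => (y t - 1 - γ * (x t - 1)) * E t) atTop (𝓝 0) :=
    tendsto_zero_of_deriv_eq_neg_mul_add hη ha0 (by positivity) (fun t _ => hB t) hRE
  have hRlim : Tendsto (fun t => R t * E t) atTop (𝓝 0) := by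
    refine squeeze_zero_norm' ((eventually_ge_atTop a).mono hRE) ?_
    simpa using Real.tendsto_exp_neg_atTop_nhds_zero.const_mul C
  have hη0 : γ - δ ≠ 0 := by linarith
  have hplim : Tendsto (fun t => (x t - 1) * E t) atTop (𝓝 (Real.exp l / (γ - δ))) := by
    have := (hAlim.sub hBlim).div_const (γ - δ)
    rw [sub_zero] at this
    refine this.congr fun t => ?_
    field_simp
    ring
  have hqlim : Tendsto (fun t => (y t - 1) * E t) atTop (𝓝 (γ * (Real.exp l / (γ - δ)))) := by
    have := (hplim.const_mul γ).add hBlim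
    rw [add_zero] at this
    exact this.congr fun t => by ring
  refine ⟨_, div_pos (Real.exp_pos l) (by linarith), hplim, hqlim, ?_⟩
  have := hRlim.sub ((hplim.add hqlim).const_mul (ν + μ))
  have hval : 0 - (ν + μ) * (Real.exp l / (γ - δ) + γ * (Real.exp l / (γ - δ))) =
      γ * (γ - 1) * (Real.exp l / (γ - δ)) := by
    linear_combination Real.exp l / (γ - δ) * (hprod - γ * hsum)
  rw [hval] at this
  exact this.congr fun t => by simp only [hRdef, hEdef]; ring

/-- In the variables `t = log r`, `x = φ / (α r)`, `y = φ' / α`, a solution of the initial value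
problem solves the phase system. -/
theorem IsIVPSolTo.isPhaseSol {n m α T : ℝ} {φ : ℝ → ℝ} {r₀ : ℝ≥0∞} (h : IsIVPSolTo n m φ r₀)
    (hα : 0 < α) (hαn : α ^ 2 * (n - 1) = m - 1)
    (hT : ∀ t < T, ENNReal.ofReal (Real.exp t) < r₀) :
    IsPhaseSol (n - 1) (m - 1) (1 / α) T (fun t => φ (Real.exp t) / (α * Real.exp t))
      (fun t => deriv φ (Real.exp t) / α) := by
  obtain ⟨hode, h0, h1⟩ := h
  refine ⟨fun t ht => ?_, fun t ht => ?_, ?_, ?_⟩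
  · obtain ⟨-, hd, -, -⟩ := hode _ (Real.exp_pos t) (hT t ht)
    have he := Real.hasDerivAt_exp t
    have hpos := Real.exp_pos t
    refine ((hd.hasDerivAt.comp t he).div (he.const_mul α) (by positivity)).congr_deriv ?_
    simp only [Function.comp_apply]
    field_simp
  · obtain ⟨hφ, -, hd, heq⟩ := hode _ (Real.exp_pos t) (hT t ht)
    have hpos := Real.exp_pos t
    refine ((hd.hasDerivAt.comp t (Real.hasDerivAt_exp t)).div_const α).congr_deriv ?_
    have h2 : 0 < 1 + deriv φ (Real.exp t) ^ 2 := by positivity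
    have h3 : deriv (deriv φ) (Real.exp t) = ((m - 1) / φ (Real.exp t)
        - (n - 1) / Real.exp t * deriv φ (Real.exp t)) * (1 + deriv φ (Real.exp t) ^ 2) := by
      rw [← heq]
      field_simp
      ring
    rw [h3, ← hαn]
    field_simp
  · have := (h0.comp Real.tendsto_exp_atBot_nhdsGT).div_const α
    refine this.congr fun t => ?_
    have hpos := Real.exp_pos t
    simp only [Function.comp_apply]
    field_simp
  · simpa using (h1.comp Real.tendsto_exp_atBot_nhdsGT).div_const α

/-- A positive solution of the phase system on `(-∞, T)` gives a solution of the initial value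
problem on `(0, e^T)`. -/
theorem IsPhaseSol.isIVPSolTo {n m α T : ℝ} {x y : ℝ → ℝ}
    (h : IsPhaseSol (n - 1) (m - 1) (1 / α) T x y) (hα : 0 < α) (hαn : α ^ 2 * (n - 1) = m - 1)
    (hx : ∀ t < T, 0 < x t) :
    IsIVPSolTo n m (fun r => α * r * x (Real.log r)) (ENNReal.ofReal (Real.exp T)) := by
  have hlt : ∀ {r : ℝ}, 0 < r → (ENNReal.ofReal r < ENNReal.ofReal (Real.exp T) ↔
      Real.log r < T) := fun hr => by
    rw [ENNReal.ofReal_lt_ofReal_iff (Real.exp_pos T), Real.log_lt_iff_lt_exp hr]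
  have hev : ∀ {r : ℝ}, 0 < r → Real.log r < T → ∀ᶠ s in 𝓝 r, 0 < s ∧ Real.log s < T :=
    fun hr hrT => (lt_mem_nhds hr).and
      ((Real.continuousAt_log hr.ne').eventually (gt_mem_nhds hrT))
  have hd1 : ∀ {r : ℝ}, 0 < r → Real.log r < T →
      HasDerivAt (fun r => α * r * x (Real.log r)) (α * y (Real.log r)) r := fun {r} hr hrT =>
    (((hasDerivAt_id r).const_mul α).mul
      ((h.deriv_fst _ hrT).comp r (Real.hasDerivAt_log hr.ne'))).congr_deriv (by
        simp only [Function.comp_apply, id]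
        field_simp
        ring)
  have hderiv : ∀ {r : ℝ}, 0 < r → Real.log r < T →
      deriv (fun r => α * r * x (Real.log r)) =ᶠ[𝓝 r] fun r => α * y (Real.log r) :=
    fun hr hrT => (hev hr hrT).mono fun s hs => (hd1 hs.1 hs.2).deriv
  refine ⟨fun r hr hrT => ?_, ?_, ?_⟩
  · rw [hlt hr] at hrT
    have hx0 := hx _ hrT
    have hd2 := (((h.deriv_snd _ hrT).comp r (Real.hasDerivAt_log hr.ne')).const_mul
      α).congr_of_eventuallyEq (hderiv hr hrT)
    refine ⟨by positivity, (hd1 hr hrT).differentiableAt, hd2.differentiableAt, ?_⟩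
    rw [hd2.deriv, (hd1 hr hrT).deriv, ← hαn]
    have : 0 < 1 + (α * y (Real.log r)) ^ 2 := by positivity
    field_simp
    ring
  · have := (h.tendsto_fst.comp Real.tendsto_log_nhdsGT_zero).const_mul α
    rw [mul_one_div_cancel hα.ne'] at this
    refine this.congr' ?_
    filter_upwards [self_mem_nhdsWithin] with r hr
    simp only [Function.comp_apply, Real.exp_log (mem_Ioi.1 hr)]
    ring
  · have := (h.tendsto_snd.comp Real.tendsto_log_nhdsGT_zero).const_mul α
    rw [mul_zero] at this
    refine this.congr' ?_
    filter_upwards [self_mem_nhdsWithin,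
      Real.tendsto_log_nhdsGT_zero.eventually (eventually_lt_atBot T)] with r hr hrT
    exact (hd1 hr hrT).deriv.symm

theorem alpha0_pos {n m : ℕ} (hn : 3 ≤ n) (hm : 2 ≤ m) : 0 < alpha0 n m := by
  have hn' : (3 : ℝ) ≤ n := by exact_mod_cast hn
  have hm' : (2 : ℝ) ≤ m := by exact_mod_cast hm
  exact Real.sqrt_pos.2 (div_pos (by linarith) (by linarith))

theorem alpha0_sq_mul {n m : ℕ} (hn : 3 ≤ n) (hm : 2 ≤ m) :
    alpha0 n m ^ 2 * ((n : ℝ) - 1) = (m : ℝ) - 1 := by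
  have hn' : (3 : ℝ) ≤ n := by exact_mod_cast hn
  have hm' : (2 : ℝ) ≤ m := by exact_mod_cast hm
  rw [alpha0, Real.sq_sqrt (div_nonneg (by linarith) (by linarith))]
  exact div_mul_cancel₀ _ (by linarith)

/-- `gammaExp n m` is a root of `γ² + (n + m - 3) γ + (n + m - 2)`, well separated from the other
root. -/
theorem gammaExp_spec {n m : ℕ} (hnm : 8 ≤ n + m) :
    gammaExp n m ^ 2 + ((n : ℝ) + m - 3) * gammaExp n m + ((n : ℝ) + m - 2) = 0 ∧
      1 ≤ 2 * gammaExp n m + ((n : ℝ) + m - 3) := by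
  have h : (8 : ℝ) ≤ n + m := by exact_mod_cast hnm
  set N : ℝ := (n : ℝ) + m with hN
  have h1 : (1 / 2 : ℝ) ^ 2 ≤ ((N - 3) / 2) ^ 2 - (N - 2) := by nlinarith
  have h2 : 1 / 2 ≤ Real.sqrt (((N - 3) / 2) ^ 2 - (N - 2)) := Real.le_sqrt_of_sq_le h1
  have h3 := Real.sq_sqrt ((sq_nonneg (1 / 2 : ℝ)).trans h1)
  rw [gammaExp, ← hN]
  constructor <;> nlinarith

theorem gammaExp_neg {n m : ℕ} (hnm : 8 ≤ n + m) : gammaExp n m < 0 := by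
  have h : (8 : ℝ) ≤ n + m := by exact_mod_cast hnm
  obtain ⟨h1, -⟩ := gammaExp_spec hnm
  by_contra! h2
  nlinarith [mul_nonneg (show (0 : ℝ) ≤ n + m - 3 by linarith) h2, sq_nonneg (gammaExp n m)]

/-- The maximal solution is global, because every solution on a bounded interval extends. -/
theorem IsIVPSolTo.eq_top {n m α : ℝ} {φ : ℝ → ℝ} {r₀ : ℝ≥0∞} (h : IsIVPSolTo n m φ r₀)
    (hn : 3 ≤ n) (hm : 1 ≤ m) (hnm : 8 ≤ n + m) (hα : 0 < α) (hαn : α ^ 2 * (n - 1) = m - 1)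
    (hr₀ : 0 < r₀) (hmax : ∀ (ψ : ℝ → ℝ) (r₁ : ℝ≥0∞), IsIVPSolTo n m ψ r₁ → r₁ ≤ r₀) :
    r₀ = ⊤ := by
  by_contra htop
  have hR : 0 < r₀.toReal := ENNReal.toReal_pos hr₀.ne' htop
  have hr₀' : r₀ = ENNReal.ofReal (Real.exp (Real.log r₀.toReal)) := by
    rw [Real.exp_log hR, ENNReal.ofReal_toReal htop]
  have hsol := h.isPhaseSol (T := Real.log r₀.toReal) hα hαn fun t ht => by
    rw [hr₀']
    exact (ENNReal.ofReal_lt_ofReal_iff (Real.exp_pos _)).2 (Real.exp_lt_exp.2 ht)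
  have hβ : 0 < 1 / α := by positivity
  obtain ⟨T', hT', X, Y, hXY⟩ :=
    hsol.exists_extension (by linarith) (by linarith) (by linarith) hβ
  have hle := hmax _ _ (hXY.isIVPSolTo hα hαn fun t ht => by
    have := (hXY.inRegion (by linarith) (by linarith) (by linarith) hβ ht).1
    linarith)
  rw [hr₀', ENNReal.ofReal_le_ofReal_iff (Real.exp_pos _).le, Real.exp_le_exp] at hle
  exact hle.not_gt hT'

/-- The maximal solution `φ` of the IVP is defined on all of `(0,∞)`, and
there is `κ = κ(m,n) > 0` such that, as `r → ∞`: `φ(r) − α₀r ∼ κ r^γ`,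
`φ(r) − rφ'(r) ∼ κ(1−γ) r^γ`, and `φ''(r) ∼ κγ(γ−1) r^{γ−2}`. -/
theorem radial_profile_asymptotics
    (n m ℓ : ℕ) (hn : 3 ≤ n) (hm : 2 ≤ m) (hl : 1 ≤ ℓ) (hnm : 8 ≤ n + m)
    (φ : ℝ → ℝ) (r₀ : ℝ≥0∞) (hr₀ : 0 < r₀)
    (hφ : IsIVPSolTo (n : ℝ) (m : ℝ) φ r₀)
    (hmax : ∀ (ψ : ℝ → ℝ) (r₁ : ℝ≥0∞), IsIVPSolTo (n : ℝ) (m : ℝ) ψ r₁ → r₁ ≤ r₀) :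
    r₀ = ⊤ ∧ ∃ κ : ℝ, 0 < κ ∧
      Tendsto (fun r : ℝ => (φ r - alpha0 n m * r) / (κ * r ^ gammaExp n m))
        atTop (𝓝 1) ∧
      Tendsto (fun r : ℝ =>
          (φ r - r * deriv φ r) / (κ * (1 - gammaExp n m) * r ^ gammaExp n m))
        atTop (𝓝 1) ∧
      Tendsto (fun r : ℝ =>
          deriv (deriv φ) r /
            (κ * gammaExp n m * (gammaExp n m - 1) * r ^ (gammaExp n m - 2)))
        atTop (𝓝 1) := by
  have hn' : (3 : ℝ) ≤ n := by exact_mod_cast hn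
  have hm' : (2 : ℝ) ≤ m := by exact_mod_cast hm
  have hnm' : (8 : ℝ) ≤ n + m := by exact_mod_cast hnm
  have hα := alpha0_pos hn hm
  have hαn := alpha0_sq_mul hn hm
  obtain ⟨hγ, hη⟩ := gammaExp_spec hnm
  have hγ0 := gammaExp_neg hnm
  set α := alpha0 n m
  set γ := gammaExp n m
  have htop : r₀ = ⊤ := hφ.eq_top hn' (by linarith) hnm' hα hαn hr₀ hmax
  subst htop
  refine ⟨rfl, ?_⟩
  have hsol := fun T : ℝ => hφ.isPhaseSol (T := T) hα hαn fun t _ => ENNReal.ofReal_lt_top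
  obtain ⟨κ, hκ, hx, hy, hy'⟩ := exists_phase_asymptotics (ν := n - 1) (μ := m - 1) (γ := γ)
    (δ := -((n : ℝ) + m - 3) - γ) (by linarith) (by linarith) (by ring) (by linarith)
    (by nlinarith) (by linarith)
    (fun t => (hsol (t + 1)).deriv_fst t (lt_add_one t))
    (fun t => (hsol (t + 1)).deriv_snd t (lt_add_one t))
    (fun t => (hsol (t + 1)).inRegion (by linarith) (by linarith) (by linarith)
      (by positivity) (lt_add_one t))
  have hpow : ∀ r > 0, Real.exp ((1 - γ) * Real.log r) = r / r ^ γ := fun r hr => by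
    rw [Real.rpow_def_of_pos hr, sub_mul, one_mul, Real.exp_sub, Real.exp_log hr, mul_comm γ]
  refine ⟨α * κ, by positivity, ?_, ?_, ?_⟩
  · have := (hx.comp Real.tendsto_log_atTop).div_const κ
    rw [div_self hκ.ne'] at this
    refine this.congr' ?_
    filter_upwards [eventually_gt_atTop 0] with r hr
    have := Real.rpow_pos_of_pos hr γ
    simp only [Function.comp_apply, Real.exp_log hr, hpow r hr]
    field_simp
  · have h1 : 1 - γ ≠ 0 := by linarith
    have := ((hx.sub hy).comp Real.tendsto_log_atTop).div_const (κ * (1 - γ))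
    rw [show κ - γ * κ = κ * (1 - γ) by ring, div_self (by positivity)] at this
    refine this.congr' ?_
    filter_upwards [eventually_gt_atTop 0] with r hr
    have := Real.rpow_pos_of_pos hr γ
    simp only [Function.comp_apply, Real.exp_log hr, hpow r hr]
    field_simp
    ring
  · have h1 : γ - 1 ≠ 0 := by linarith
    have := (hy'.comp Real.tendsto_log_atTop).div_const (γ * (γ - 1) * κ)
    rw [div_self (by simp [hγ0.ne, h1, hκ.ne'])] at this
    refine this.congr' ?_
    filter_upwards [eventually_gt_atTop 0] with r hr
    have := Real.rpow_pos_of_pos hr γ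
    have hd := (hφ.1 r hr ENNReal.ofReal_lt_top).2.2.1.hasDerivAt
    rw [← Real.exp_log hr] at hd
    have heq := ((hd.comp _ (Real.hasDerivAt_exp _)).div_const α).unique
      ((hsol (Real.log r + 1)).deriv_snd _ (lt_add_one _))
    simp only [Function.comp_apply]
    rw [← heq, hpow r hr, Real.exp_log hr, Real.rpow_sub hr, Real.rpow_two]
    have := hγ0.ne
    field_simp
end
end
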